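/- Let H be a graph that is 3-connected or isomorphic to K_3, let q, d ≥ 2 be integers, and let F = {f₁, f₂} be a matching of two edges (so F does not contain a copy of H when H has at least 3 vertices), and let e be an edge vertex-disjoint from F. Then there exists a graph G₂ containing an induced copy F̃ of F (with edges f₁, f₂) and an edge e vertex-disjoint from F̃ such that: every path in G₂ from F̃ to an endpoint of e has length at least d; every path in G₂ from an endpoint of f₁ to an endpoint of f₂ has length at least d; G₂ satisfies (I1), (I2) and Property T of an (H, F, e, q, d)-indicator; and instead of (I3), G₂ satisfies (I3'): for every ℓ ∈ {1,2} and all colours i, j ∈ {1,…,q} with i ≠ j, there exists an H-free q-colouring of G₂ in which f_ℓ has colour i and both e and f_{3−ℓ} have colour j. -/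

import Mathlib

open SimpleGraph

/-- The colouring `c` contains a copy of `H` in `G` all of whose edges have colour `i`. -/
def HasMonoCopyColor {V W : Type*} (G : SimpleGraph V) (H : SimpleGraph W) {q : ℕ}
    (c : Sym2 V → Fin q) (i : Fin q) : Prop :=
  ∃ f : W ↪ V, ∀ a b, H.Adj a b → G.Adj (f a) (f b) ∧ c s(f a, f b) = i

/-- The colouring `c` contains a monochromatic copy of `H` in `G`. -/
def HasMonoCopy {V W : Type*} (G : SimpleGraph V) (H : SimpleGraph W) {q : ℕ}
    (c : Sym2 V → Fin q) : Prop :=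
  ∃ i : Fin q, HasMonoCopyColor G H c i

/-- `G` is `q`-Ramsey for `H`: every `q`-colouring of the edges of `G` contains a
monochromatic copy of `H`. -/
def IsRamsey (q : ℕ) {V W : Type*} (G : SimpleGraph V) (H : SimpleGraph W) : Prop :=
  ∀ c : Sym2 V → Fin q, HasMonoCopy G H c

/-- `H` is 3-connected: it has at least 4 vertices and deleting any set of at most
2 vertices leaves a connected graph. -/
def ThreeConnected {V : Type*} [Fintype V] (H : SimpleGraph V) : Prop :=
  4 ≤ Fintype.card V ∧
    ∀ S : Finset V, S.card ≤ 2 → (H.induce ((↑S : Set V)ᶜ)).Connected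

/-- `H` is 3-connected or isomorphic to `K₃`. -/
def ThreeConnOrK3 {V : Type*} [Fintype V] (H : SimpleGraph V) : Prop :=
  ThreeConnected H ∨ Nonempty (H ≃g (⊤ : SimpleGraph (Fin 3)))

/-- The basic properties of an `(H, F, e, q, d)`-indicator `G`, with the induced copy of
`F` given by the graph embedding `φ` and the edge `e = e₁e₂`: the edge `e` is
vertex-disjoint from the copy of `F`, every path from the copy of `F` to an endpoint of
`e` has length at least `d`, and properties (I1) and (I2) hold. -/
def IndicatorBase (q d : ℕ) {V VH VF : Type*} (H : SimpleGraph VH) (F : SimpleGraph VF)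
    (G : SimpleGraph V) (φ : F ↪g G) (e₁ e₂ : V) : Prop :=
  G.Adj e₁ e₂ ∧
  (∀ a : VF, φ a ≠ e₁ ∧ φ a ≠ e₂) ∧
  (∀ (a : VF) (v : V), (v = e₁ ∨ v = e₂) → ∀ p : G.Walk (φ a) v, d ≤ p.length) ∧
  -- (I1)
  (∀ i : Fin q, ∃ c : Sym2 V → Fin q, ¬ HasMonoCopy G H c ∧
    ∀ a b, F.Adj a b → c s(φ a, φ b) = i) ∧
  -- (I2)
  (∀ (i : Fin q) (c : Sym2 V → Fin q), ¬ HasMonoCopy G H c →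
    (∀ a b, F.Adj a b → c s(φ a, φ b) = i) → c s(e₁, e₂) = i)

/-- Property (I3) of an `(H, F, e, q, d)`-indicator: for all colours `i, j` and every edge
`f = ab` of the copy of `F`, there is an `H`-free `q`-colouring of `G − f` in which the
copy of `F` minus `f` is monochromatic of colour `i` and `e` has colour `j`. -/
def IndicatorI3 (q : ℕ) {V VH VF : Type*} (H : SimpleGraph VH) (F : SimpleGraph VF)
    (G : SimpleGraph V) (φ : F ↪g G) (e₁ e₂ : V) : Prop :=
  ∀ (i j : Fin q) (a b : VF), F.Adj a b →
    ∃ c : Sym2 V → Fin q,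
      ¬ HasMonoCopy (G.deleteEdges {s(φ a, φ b)}) H c ∧
      (∀ a' b', F.Adj a' b' → s(a', b') ≠ s(a, b) → c s(φ a', φ b') = i) ∧
      c s(e₁, e₂) = j

/-- Property T of an indicator: a collection `T f` of subgraphs of `G`, indexed by the
edges `f` of the copy of `F`, satisfying (T1), (T2) and (T3). -/
def HasPropertyT (d : ℕ) {V VF : Type*} (F : SimpleGraph VF)
    (G : SimpleGraph V) (φ : F ↪g G) : Prop :=
  ∃ T : Sym2 VF → G.Subgraph,
    -- (T1)
    (∀ a b, F.Adj a b →
      (T s(a, b)).verts ∩ Set.range (fun x => φ x) = {φ a, φ b} ∧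
      (T s(a, b)).Adj (φ a) (φ b)) ∧
    -- (T2)
    (∀ v : V, ∃ a b, F.Adj a b ∧ v ∈ (T s(a, b)).verts) ∧
    (∀ x y : V, G.Adj x y → ∃ a b, F.Adj a b ∧ (T s(a, b)).Adj x y) ∧
    -- (T3)
    (∀ a b a' b', F.Adj a b → F.Adj a' b' → s(a, b) ≠ s(a', b') →
      ∀ v ∈ (T s(a, b)).verts ∩ (T s(a', b')).verts,
        v ∈ Set.range (fun x => φ x) ∨
          ∀ (w : VF) (p : G.Walk v (φ w)), d ≤ p.length)

/-- The matching with two edges `f₁ = {0,1}` and `f₂ = {2,3}`. -/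
def twoMatching : SimpleGraph (Fin 4) :=
  SimpleGraph.fromRel (fun x y => (x = 0 ∧ y = 1) ∨ (x = 2 ∧ y = 3))

/-! ### Preliminaries on `H` and on monochromatic copies -/

/-- The consequence of `ThreeConnOrK3` used throughout: at least three vertices, and deleting
at most two vertices leaves a connected graph. -/
structure Robust {VH : Type*} [Fintype VH] (H : SimpleGraph VH) : Prop where
  three_le : 3 ≤ Fintype.card VH
  conn : ∀ S : Finset VH, S.card ≤ 2 → (H.induce ((↑S : Set VH)ᶜ)).Connected

theorem ThreeConnOrK3.robust {VH : Type*} [Fintype VH] {H : SimpleGraph VH}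
    (h : ThreeConnOrK3 H) : Robust H := by
  classical
  rcases h with ⟨h4, hc⟩ | ⟨⟨e⟩⟩
  · exact ⟨by omega, hc⟩
  · have hcard : Fintype.card VH = 3 := by
      simpa using Fintype.card_congr e.toEquiv
    refine ⟨hcard.ge, fun S hS => ?_⟩
    have hadj : ∀ a b : VH, a ≠ b → H.Adj a b := fun a b hab => by
      rw [← e.map_adj_iff]
      simpa using hab
    obtain ⟨v, hv⟩ : ∃ v, v ∉ S := by
      by_contra! hall
      have : S = Finset.univ := by ext; simp [hall]
      rw [this, Finset.card_univ] at hS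
      omega
    have : Nonempty ↥((↑S : Set VH)ᶜ) := ⟨⟨v, by simpa using hv⟩⟩
    refine ⟨fun a b => ?_⟩
    by_cases hab : a = b
    · subst hab; exact Reachable.refl _
    · exact Adj.reachable (by
        rw [comap_adj]
        exact hadj _ _ fun h => hab (Subtype.ext h))

theorem Robust.exists_adj_ne {VH : Type*} [Fintype VH] {H : SimpleGraph VH} (hH : Robust H)
    (a c : VH) : ∃ b, H.Adj a b ∧ b ≠ c := by
  classical
  have hcard : (({c} : Finset VH).erase a).card ≤ 2 :=
    (Finset.card_le_card (Finset.erase_subset _ _)).trans (by simp)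
  obtain ⟨x, hx⟩ : ∃ x, x ∉ ({a, c} : Finset VH) := by
    by_contra! hall
    have : ({a, c} : Finset VH) = Finset.univ := by ext; simp only [hall, Finset.mem_univ]
    have h2 := Finset.card_le_two (a := a) (b := c)
    rw [this, Finset.card_univ] at h2
    have := hH.three_le
    omega
  simp only [Finset.mem_insert, Finset.mem_singleton, not_or] at hx
  obtain ⟨p⟩ := (hH.conn _ hcard).preconnected ⟨a, by simp⟩ ⟨x, by simp [hx.1, hx.2]⟩
  cases p with
  | nil => exact absurd rfl hx.1
  | @cons _ y _ hadj _ =>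
    have hy := y.2
    rw [comap_adj] at hadj
    refine ⟨y, hadj, fun hyc => ?_⟩
    simp only [Finset.coe_erase, Finset.coe_singleton, Set.mem_compl_iff, Set.mem_sdiff,
      Set.mem_singleton_iff, not_and, not_not] at hy
    exact hadj.ne (hy hyc).symm

theorem Robust.exists_adj {VH : Type*} [Fintype VH] {H : SimpleGraph VH} (hH : Robust H)
    (a : VH) : ∃ b, H.Adj a b := (hH.exists_adj_ne a a).imp fun _ h => h.1

theorem Robust.nonempty {VH : Type*} [Fintype VH] {H : SimpleGraph VH} (hH : Robust H) :
    Nonempty VH := Fintype.card_pos_iff.1 (by have := hH.three_le; omega)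

/-- The map `f` is a copy of `H` in `G`. -/
def IsCopy {V W : Type*} (H : SimpleGraph W) (G : SimpleGraph V) (f : W ↪ V) : Prop :=
  ∀ a b, H.Adj a b → G.Adj (f a) (f b)

theorem IsCopy.mono {V W : Type*} {H : SimpleGraph W} {G G' : SimpleGraph V} {f : W ↪ V}
    (h : IsCopy H G f) (hG : G ≤ G') : IsCopy H G' f := fun a b hab => hG (h a b hab)

theorem IsCopy.exists_comp {VH V W : Type*} [Fintype VH] {H : SimpleGraph VH} (hH : Robust H)
    {G : SimpleGraph W} {m : W ↪ V} {f : VH ↪ V} (hf : IsCopy H (G.map m) f) :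
    ∃ g : VH ↪ W, (∀ a, m (g a) = f a) ∧ IsCopy H G g := by
  have : ∀ a, ∃ w, m w = f a := fun a => by
    obtain ⟨b, hb⟩ := hH.exists_adj a
    obtain ⟨x, y, _, hx, _⟩ := (map_adj _ _ _ _).1 (hf a b hb)
    exact ⟨x, hx⟩
  choose g hg using this
  refine ⟨⟨g, fun a b hab => f.injective ?_⟩, hg, fun a b hab => ?_⟩
  · rw [← hg, ← hg, hab]
  · obtain ⟨x, y, hxy, hx, hy⟩ := (map_adj _ _ _ _).1 (hf a b hab)
    rw [← hg] at hx hy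
    rwa [m.injective hx, m.injective hy] at hxy

theorem HasMonoCopy.mono {V W : Type*} {q : ℕ} {H : SimpleGraph W} {G G' : SimpleGraph V}
    {c c' : Sym2 V → Fin q} (h : HasMonoCopy G H c) (hG : G ≤ G')
    (hc : ∀ x y, G.Adj x y → c' s(x, y) = c s(x, y)) : HasMonoCopy G' H c' := by
  obtain ⟨i, f, hf⟩ := h
  exact ⟨i, f, fun a b hab => ⟨hG (hf a b hab).1, by rw [hc _ _ (hf a b hab).1, (hf a b hab).2]⟩⟩

theorem HasMonoCopy.map {V U W : Type*} {q : ℕ} {H : SimpleGraph W} {G : SimpleGraph U}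
    {m : U ↪ V} {c : Sym2 V → Fin q} (h : HasMonoCopy G H (fun s => c (s.map m))) :
    HasMonoCopy (G.map m) H c := by
  obtain ⟨i, f, hf⟩ := h
  exact ⟨i, f.trans m, fun a b hab => ⟨(map_adj_apply).2 (hf a b hab).1, (hf a b hab).2⟩⟩

theorem HasMonoCopy.of_map {V U VH : Type*} [Fintype VH] {q : ℕ} {H : SimpleGraph VH}
    (hH : Robust H) {G : SimpleGraph U} {m : U ↪ V} {c : Sym2 V → Fin q}
    (h : HasMonoCopy (G.map m) H c) : HasMonoCopy G H (fun s => c (s.map m)) := by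
  obtain ⟨i, f, hf⟩ := h
  obtain ⟨g, hg, hcopy⟩ := IsCopy.exists_comp (f := f) hH fun a b hab => (hf a b hab).1
  refine ⟨i, g, fun a b hab => ⟨hcopy a b hab, ?_⟩⟩
  change c s(m (g a), m (g b)) = i
  rw [hg, hg]
  exact (hf a b hab).2

theorem HasMonoCopy.of_perm {V W : Type*} {q : ℕ} {H : SimpleGraph W} {G : SimpleGraph V}
    {c : Sym2 V → Fin q} (σ : Equiv.Perm (Fin q)) (h : HasMonoCopy G H (fun s => σ (c s))) :
    HasMonoCopy G H c := by
  obtain ⟨i, f, hf⟩ := h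
  exact ⟨σ.symm i, f, fun a b hab => ⟨(hf a b hab).1, by rw [← (hf a b hab).2]; simp⟩⟩

theorem exists_colouring {V : Type*} {q : ℕ} (hq : 0 < q) (R : V → V → Fin q → Prop)
    (hsymm : ∀ x y i, R x y i → R y x i) (huniq : ∀ x y i j, R x y i → R x y j → i = j) :
    ∃ c : Sym2 V → Fin q, ∀ x y i, R x y i → c s(x, y) = i := by
  classical
  have : ∀ s : Sym2 V, ∃ i : Fin q, ∀ x y j, s = s(x, y) → R x y j → i = j := by
    intro s
    induction s with | _ x y
    by_cases h : ∃ i, R x y i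
    · obtain ⟨i, hi⟩ := h
      refine ⟨i, fun x' y' j hs hj => ?_⟩
      rcases Sym2.eq_iff.1 hs with ⟨rfl, rfl⟩ | ⟨rfl, rfl⟩
      · exact huniq _ _ _ _ hi hj
      · exact huniq _ _ _ _ hi (hsymm _ _ _ hj)
    · refine ⟨⟨0, hq⟩, fun x' y' j hs hj => (h ?_).elim⟩
      rcases Sym2.eq_iff.1 hs with ⟨rfl, rfl⟩ | ⟨rfl, rfl⟩
      · exact ⟨j, hj⟩
      · exact ⟨j, hsymm _ _ _ hj⟩
  choose c hc using this
  exact ⟨c, fun x y i h => hc _ x y i rfl h⟩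

/-- If two graphs overlap in at most two vertices, and agree there, then every copy of `H` in
their union lies in one of them. -/
theorem IsCopy.of_sup {V VH : Type*} [Fintype VH] {H : SimpleGraph VH} (hH : Robust H)
    {G₁ G₂ : SimpleGraph V} {S₁ S₂ : Set V} {u v : V} {f : VH ↪ V}
    (h₁ : ∀ x y, G₁.Adj x y → x ∈ S₁) (h₂ : ∀ x y, G₂.Adj x y → x ∈ S₂)
    (hS : ∀ x ∈ S₁, x ∈ S₂ → x = u ∨ x = v) (huv : G₁.Adj u v ↔ G₂.Adj u v)
    (hf : IsCopy H (G₁ ⊔ G₂) f) : IsCopy H G₁ f ∨ IsCopy H G₂ f := by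
  classical
  set S : Finset VH := Finset.univ.filter fun a => f a = u ∨ f a = v with hSdef
  have hScard : S.card ≤ 2 := by
    rw [← Finset.card_map f]
    refine (Finset.card_le_card (t := {u, v}) fun x hx => ?_).trans Finset.card_le_two
    simp only [hSdef, Finset.mem_map, Finset.mem_filter, Finset.mem_univ, true_and] at hx
    obtain ⟨a, ha, rfl⟩ := hx
    simpa using ha
  have hmem : ∀ a, a ∈ S ↔ f a = u ∨ f a = v := by simp [hSdef]
  have hconn := (hH.conn S hScard).preconnected
  have hinv : ∀ a b : ↥((↑S : Set VH)ᶜ), f a ∈ S₁ → f b ∈ S₁ := by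
    intro a b ha
    obtain ⟨p⟩ := hconn a b
    induction p with
    | nil => exact ha
    | @cons x y z hadj _ ih =>
      apply ih
      rcases hf _ _ hadj with h | h
      · exact h₁ _ _ h.symm
      · exact absurd ((hmem x).2 (hS _ ha (h₂ _ _ h))) fun h' => x.2 h'
  have hboth : ∀ a b, a ∈ S → b ∈ S → H.Adj a b → G₁.Adj (f a) (f b) ∧ G₂.Adj (f a) (f b) := by
    intro a b ha hb hab
    have hne : f a ≠ f b := fun h => hab.ne (f.injective h)
    have := hf a b hab
    rcases (hmem a).1 ha with h | h <;> rcases (hmem b).1 hb with h' | h' <;>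
      rw [h, h'] at this hne ⊢
    · exact absurd rfl hne
    · rcases this with t | t
      exacts [⟨t, huv.1 t⟩, ⟨huv.2 t, t⟩]
    · rcases this with t | t
      exacts [⟨t, (huv.1 t.symm).symm⟩, ⟨(huv.2 t.symm).symm, t⟩]
    · exact absurd rfl hne
  by_cases hex : ∃ a : ↥((↑S : Set VH)ᶜ), f a ∈ S₁
  · obtain ⟨a₀, ha₀⟩ := hex
    left
    have key : ∀ a b, a ∉ S → H.Adj a b → G₁.Adj (f a) (f b) := by
      intro a b ha hab
      refine (hf a b hab).resolve_right fun h => ?_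
      exact ha ((hmem a).2 (hS _ (hinv a₀ ⟨a, by simpa using ha⟩ ha₀) (h₂ _ _ h)))
    intro a b hab
    by_cases ha : a ∈ S
    · by_cases hb : b ∈ S
      · exact (hboth a b ha hb hab).1
      · exact (key b a hb hab.symm).symm
    · exact key a b ha hab
  · push Not at hex
    right
    have key : ∀ a b, a ∉ S → H.Adj a b → G₂.Adj (f a) (f b) := by
      intro a b ha hab
      exact (hf a b hab).resolve_left fun h => hex ⟨a, by simpa using ha⟩ (h₁ _ _ h)
    intro a b hab
    by_cases ha : a ∈ S
    · by_cases hb : b ∈ S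
      · exact (hboth a b ha hb hab).2
      · exact (key b a hb hab.symm).symm
    · exact key a b ha hab

theorem Finset.exists_insert_step {α : Type*} [Fintype α] [DecidableEq α] (p : Finset α → Prop)
    (h0 : p ∅) (h1 : ¬ p Finset.univ) : ∃ F a, a ∉ F ∧ p F ∧ ¬ p (insert a F) := by
  by_contra! h
  exact h1 (Finset.induction_on Finset.univ h0 fun a F ha hF => h F a ha hF)

/-! ### Ramsey graphs and star gadgets -/

theorem Fintype.exists_mono_embedding (q : ℕ) (κ : Type) [Fintype κ] :
    ∃ (P : Type) (_ : Fintype P), ∀ χ : P → Fin q, ∃ (β : κ ↪ P) (i : Fin q),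
      ∀ x, χ (β x) = i := by
  classical
  refine ⟨Fin (q * Fintype.card κ + 1), inferInstance, fun χ => ?_⟩
  obtain ⟨i, hi⟩ := Fintype.exists_lt_card_fiber_of_mul_lt_card (f := χ)
    (n := Fintype.card κ) (by simp)
  obtain ⟨β⟩ : Nonempty (κ ↪ {x // x ∈ Finset.univ.filter fun x => χ x = i}) := by
    rw [Function.Embedding.nonempty_iff_card_le, Fintype.card_coe]
    exact hi.le
  exact ⟨β.trans (Function.Embedding.subtype _), i, fun x => (Finset.mem_filter.1 (β x).2).2⟩

theorem exists_end_mono (q m : ℕ) : ∃ N : ℕ, ∀ (V : Type) (S : Finset V) (c : Sym2 V → Fin q),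
    N ≤ S.card → ∃ (v : Fin m ↪ V) (col : Fin m → Fin q), (∀ i, v i ∈ S) ∧
      ∀ i j, i < j → c s(v i, v j) = col i := by
  classical
  induction m with
  | zero =>
    exact ⟨0, fun V S c _ => ⟨⟨Fin.elim0, fun i => i.elim0⟩, Fin.elim0, fun i => i.elim0,
      fun i => i.elim0⟩⟩
  | succ m ih =>
    obtain ⟨N, hN⟩ := ih
    refine ⟨q * N + 2, fun V S c hS => ?_⟩
    obtain ⟨u, hu⟩ : S.Nonempty := Finset.card_pos.1 (by omega)
    have hcard : (S.erase u).card = S.card - 1 := Finset.card_erase_of_mem hu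
    obtain ⟨i, -, hi⟩ := Finset.exists_lt_card_fiber_of_mul_lt_card_of_maps_to
      (s := S.erase u) (t := (Finset.univ : Finset (Fin q))) (f := fun w => c s(u, w)) (n := N)
      (fun _ _ => Finset.mem_univ _) (by rw [hcard]; simp; omega)
    obtain ⟨v, col, hv, hcol⟩ := hN V _ c hi.le
    simp only [Finset.mem_filter, Finset.mem_erase] at hv
    refine ⟨⟨Fin.cons u v, ?_⟩, Fin.cons i col, ?_, ?_⟩
    · rw [Fin.cons_injective_iff]
      exact ⟨fun ⟨j, hj⟩ => (hv j).1.1 hj, v.injective⟩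
    · intro j
      refine Fin.cases hu (fun j => (hv j).1.2) j
    · intro j k hjk
      induction k using Fin.cases with
      | zero => exact absurd hjk (Fin.not_lt_zero j)
      | succ k =>
        induction j using Fin.cases with
        | zero => exact (hv k).2
        | succ j => exact hcol j k (Fin.succ_lt_succ_iff.1 hjk)

theorem exists_isRamsey_top {VH : Type} [Fintype VH] (H : SimpleGraph VH) (q : ℕ) :
    ∃ N : ℕ, IsRamsey q (⊤ : SimpleGraph (Fin N)) H := by
  classical
  obtain ⟨P, _, hP⟩ := Fintype.exists_mono_embedding q VH
  obtain ⟨N, hN⟩ := exists_end_mono q (Fintype.card P)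
  refine ⟨N, fun c => ?_⟩
  obtain ⟨v, col, -, hcol⟩ := hN (Fin N) Finset.univ c (by simp)
  let e := Fintype.equivFin P
  obtain ⟨β, i, hβ⟩ := hP fun x => col (e x)
  refine ⟨i, β.trans (e.toEmbedding.trans v), fun a b hab => ⟨?_, ?_⟩⟩
  · rw [top_adj]
    exact fun h => hab.ne ((β.trans (e.toEmbedding.trans v)).injective h)
  · have hne : e (β a) ≠ e (β b) := fun h => hab.ne (β.injective (e.injective h))
    change c s(v (e (β a)), v (e (β b))) = i
    rcases lt_or_gt_of_ne hne with h | h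
    · rw [hcol _ _ h, hβ]
    · rw [Sym2.eq_swap, hcol _ _ h, hβ]

/-- A graph that has an `H`-free colouring, but none in which the edges from the root `u` to
the terminals `t x` all have the same colour. -/
structure StarGadget (q : ℕ) {VH W κ : Type} (H : SimpleGraph VH) (G : SimpleGraph W) (u : W)
    (t : κ ↪ W) : Prop where
  adj : ∀ x, G.Adj u (t x)
  not_ramsey : ¬ IsRamsey q G H
  not_mono : ∀ c : Sym2 W → Fin q, ¬ HasMonoCopy G H c → ¬ ∃ i, ∀ x, c s(u, t x) = i

theorem exists_starGadget {VH : Type} [Fintype VH] {H : SimpleGraph VH} (hH : Robust H)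
    {q : ℕ} (hq : 2 ≤ q) : ∃ (W κ : Type) (_ : Fintype W) (_ : Fintype κ) (G : SimpleGraph W)
      (u : W) (t : κ ↪ W), StarGadget q H G u t := by
  classical
  obtain ⟨N, hN⟩ := exists_isRamsey_top H q
  obtain ⟨a₀⟩ := hH.nonempty
  obtain ⟨b₀, hab₀⟩ := hH.exists_adj a₀
  obtain ⟨F, s, -, hF, hs⟩ := Finset.exists_insert_step
    (fun F : Finset (Sym2 (Fin N)) => ¬ IsRamsey q (fromEdgeSet (↑F : Set (Sym2 (Fin N)))) H)
    (fun h => by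
      obtain ⟨i, f, hf⟩ := h fun _ => ⟨0, by omega⟩
      simpa using (hf _ _ hab₀).1)
    (by simpa using hN)
  rw [not_not] at hs
  induction s with | _ u v
  set G := fromEdgeSet (↑F : Set (Sym2 (Fin N))) with hG
  refine ⟨Fin N, {x // G.Adj u x}, inferInstance, inferInstance, G, u,
    Function.Embedding.subtype _, fun x => x.2, hF, ?_⟩
  rintro c hc ⟨i, hi⟩
  obtain ⟨j, hj⟩ : ∃ j : Fin q, j ≠ i := by
    have : Nontrivial (Fin q) := Fin.nontrivial_iff_two_le.2 hq
    exact exists_ne i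
  obtain ⟨k, f, hf⟩ := hs (Function.update c s(u, v) j)
  have hold : ∀ a b, H.Adj a b → s(f a, f b) ≠ s(u, v) →
      G.Adj (f a) (f b) ∧ c s(f a, f b) = k := fun a b hab hne => by
    obtain ⟨h1, h2⟩ := hf a b hab
    rw [Function.update_of_ne hne] at h2
    refine ⟨?_, h2⟩
    rw [fromEdgeSet_adj] at h1
    rw [hG, fromEdgeSet_adj]
    simp only [Finset.coe_insert, Set.mem_insert_iff, hne, false_or] at h1
    exact h1
  have key : ∀ a b, f a = u → f b = v → H.Adj a b → False := fun a b ha hb hab => by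
    obtain ⟨b', hab', hb'⟩ := hH.exists_adj_ne a b
    have hk : k = j := by rw [← (hf a b hab).2, ha, hb, Function.update_self]
    obtain ⟨h1, h2⟩ := hold a b' hab' fun h => hb' (f.injective (by
      rw [ha] at h
      rw [hb]
      exact (Sym2.congr_right).1 h))
    rw [ha] at h1 h2
    exact hj (hk.symm.trans (h2.symm.trans (hi ⟨f b', h1⟩)))
  refine hc ⟨k, f, fun a b hab => hold a b hab fun h => ?_⟩
  rcases Sym2.eq_iff.1 h with ⟨h1, h2⟩ | ⟨h1, h2⟩
  · exact key a b h1 h2 hab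
  · exact key b a h2 h1 hab.symm

/-! ### Sparse hypergraphs of large chromatic number -/

/-- A finite family of sets is tree-like if it can be assembled by repeatedly uniting
disjoint tree-like subfamilies whose unions share at most one point. -/
inductive TreeLike {V J : Type} [DecidableEq J] (B : J → Set V) : Finset J → Prop
  | empty : TreeLike B ∅
  | single (j : J) : TreeLike B {j}
  | union {F₁ F₂ : Finset J} : TreeLike B F₁ → TreeLike B F₂ → Disjoint F₁ F₂ →
      (∀ j₁ ∈ F₁, ∀ j₂ ∈ F₂, ∀ k₁ ∈ F₁, ∀ k₂ ∈ F₂, ∀ v w, v ∈ B j₁ → v ∈ B j₂ →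
        w ∈ B k₁ → w ∈ B k₂ → v = w) → TreeLike B (F₁ ∪ F₂)

theorem TreeLike.linear {V J : Type} [DecidableEq J] {B : J → Set V} {F : Finset J}
    (h : TreeLike B F) : ∀ i ∈ F, ∀ j ∈ F, i ≠ j → ∀ v w, v ∈ B i → v ∈ B j → w ∈ B i →
      w ∈ B j → v = w := by
  induction h with
  | empty => simp
  | single j =>
    intro i hi k hk hik
    rw [Finset.mem_singleton] at hi hk
    exact absurd (hi.trans hk.symm) hik
  | @union F₁ F₂ _ _ _ hF ih₁ ih₂ =>
    intro i hi j hj hij v w hv hv' hw hw'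
    rcases Finset.mem_union.1 hi with hi | hi <;> rcases Finset.mem_union.1 hj with hj | hj
    · exact ih₁ i hi j hj hij v w hv hv' hw hw'
    · exact hF i hi j hj i hi j hj v w hv hv' hw hw'
    · exact hF j hj i hi j hj i hi v w hv' hv hw' hw
    · exact ih₂ i hi j hj hij v w hv hv' hw hw'

theorem TreeLike.image {V U J I : Type} [DecidableEq J] [DecidableEq I] {B : J → Set V}
    {C : I → Set U} {g : J → I} {m : V → U} (hg : g.Injective) (hm : m.Injective)
    (hC : ∀ j, C (g j) = m '' B j) {F : Finset J} (h : TreeLike B F) :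
    TreeLike C (F.image g) := by
  induction h with
  | empty => rw [Finset.image_empty]; exact .empty
  | single j => rw [Finset.image_singleton]; exact .single _
  | @union F₁ F₂ _ _ hd hF ih₁ ih₂ =>
    rw [Finset.image_union]
    refine .union ih₁ ih₂ ((Finset.disjoint_image hg).2 hd) ?_
    simp only [Finset.mem_image]
    rintro _ ⟨j₁, h₁, rfl⟩ _ ⟨j₂, h₂, rfl⟩ _ ⟨k₁, h₃, rfl⟩ _ ⟨k₂, h₄, rfl⟩ v w
    simp only [hC]
    rintro ⟨a, ha, rfl⟩ ⟨a', ha', h⟩ ⟨b, hb, rfl⟩ ⟨b', hb', h'⟩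
    rw [hm h] at ha'
    rw [hm h'] at hb'
    rw [hF j₁ h₁ j₂ h₂ k₁ h₃ k₂ h₄ a b ha ha' hb hb']

theorem TreeLike.of_subsingleton_inter {V J : Type} [DecidableEq J] {B : J → Set V}
    (F : Finset J) (h : ∀ j ∈ F, ∀ i ∈ F, ∀ k ∈ F, i ≠ j → k ≠ j → ∀ v w, v ∈ B j → v ∈ B i →
      w ∈ B j → w ∈ B k → v = w) : TreeLike B F := by
  induction F using Finset.induction_on with
  | empty => exact .empty
  | insert a F ha ih =>
    rw [Finset.insert_eq]
    refine .union (.single a) (ih fun j hj i hi k hk => h j (Finset.mem_insert_of_mem hj) i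
      (Finset.mem_insert_of_mem hi) k (Finset.mem_insert_of_mem hk))
      (Finset.disjoint_singleton_left.2 ha) ?_
    intro j₁ h₁ j₂ h₂ k₁ h₃ k₂ h₄ v w hv hv' hw hw'
    rw [Finset.mem_singleton] at h₁ h₃
    subst h₁ h₃
    exact h _ (Finset.mem_insert_self _ _) j₂ (Finset.mem_insert_of_mem h₂) k₂
      (Finset.mem_insert_of_mem h₄) (fun e => ha (e ▸ h₂)) (fun e => ha (e ▸ h₄)) v w hv hv' hw hw'

/-- The family of injections `A j : κ ↪ V` has only tree-like subfamilies of size at most `s`. -/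
def Sparse {V J κ : Type} [DecidableEq J] (s : ℕ) (A : J → κ ↪ V) : Prop :=
  ∀ F : Finset J, F.card ≤ s → TreeLike (fun j => Set.range (A j)) F

theorem exists_sparse_partite (κ : Type) [Fintype κ] {q : ℕ} (hq : 0 < q) (s : ℕ)
    (ih : ∀ (κ' : Type) [Fintype κ'], ∃ (V J : Type) (_ : Fintype V) (_ : Fintype J)
      (_ : DecidableEq J) (A : J → κ' ↪ V), Sparse s A ∧
      ∀ χ : V → Fin q, ∃ j i, ∀ x, χ (A j x) = i)
    (P : Type) [Fintype P] [DecidableEq P] (Q : Finset P) :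
    ∃ (V J : Type) (_ : Fintype V) (_ : Fintype J) (_ : DecidableEq J) (A : J → κ ↪ V)
      (π : V → P), Sparse (s + 1) A ∧ (∀ j x y, π (A j x) = π (A j y) → x = y) ∧
      ∀ χ : V → Fin q, ∃ col : P → Fin q, ∀ β : κ ↪ P, ∃ j, (∀ x, π (A j x) = β x) ∧
        ∀ x, β x ∈ Q → χ (A j x) = col (β x) := by
  classical
  induction Q using Finset.induction_on with
  | empty =>
    refine ⟨(κ ↪ P) × κ, κ ↪ P, inferInstance, inferInstance, inferInstance,
      fun β => ⟨fun x => (β, x), fun x y h => (Prod.mk.inj h).2⟩, fun v => v.1 v.2, ?_, ?_, ?_⟩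
    · intro F _
      refine TreeLike.of_subsingleton_inter F ?_
      rintro j _ i _ k _ hij - v w ⟨x, rfl⟩ ⟨y, hy⟩
      exact absurd (Prod.mk.inj hy).1 hij
    · exact fun j x y h => j.injective h
    · exact fun χ => ⟨fun _ => ⟨0, hq⟩, fun β => ⟨β, fun _ => rfl, by simp⟩⟩
  | insert p Q hp hQ =>
    obtain ⟨V, J, _, _, _, A, π, hA, hπ, hχ⟩ := hQ
    obtain ⟨Y, L, _, _, _, M, hM, hMχ⟩ := ih {v // π v = p}
    let ι : L → V ↪ Y ⊕ (L × V) := fun l =>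
      ⟨fun v => if h : π v = p then .inl (M l ⟨v, h⟩) else .inr (l, v), by
        intro v w h
        dsimp only at h
        split_ifs at h with h1 h2 h2
        · simpa using (M l).injective (Sum.inl_injective h)
        · simpa using h⟩
    have ι_eq : ∀ l v, ι l v = if h : π v = p then .inl (M l ⟨v, h⟩) else .inr (l, v) :=
      fun _ _ => rfl
    have ι_meet : ∀ l l' v v', l ≠ l' → ι l v = ι l' v' →
        ∃ (h : π v = p) (h' : π v' = p), M l ⟨v, h⟩ = M l' ⟨v', h'⟩ := by
      intro l l' v v' hl h
      rw [ι_eq, ι_eq] at h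
      split_ifs at h with h1 h2 h2
      · exact ⟨h1, h2, Sum.inl_injective h⟩
      · exact absurd (Prod.mk.inj (Sum.inr_injective h)).1 hl
    refine ⟨Y ⊕ (L × V), L × J, inferInstance, inferInstance, inferInstance,
      fun lj => (A lj.2).trans (ι lj.1), Sum.elim (fun _ => p) (fun lv => π lv.2), ?_, ?_, ?_⟩
    · intro F hF
      by_cases hcard : (F.image Prod.fst).card ≤ s
      · have aux : ∀ F₁ : Finset L, TreeLike (fun l => Set.range (M l)) F₁ →
            ∀ F : Finset (L × J), F.card ≤ s + 1 → (∀ lj ∈ F, lj.1 ∈ F₁) →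
            TreeLike (fun lj : L × J => Set.range ((A lj.2).trans (ι lj.1))) F := by
          intro F₁ h
          induction h with
          | empty =>
            intro F _ hF
            have : F = ∅ := Finset.eq_empty_of_forall_notMem fun lj h => by simpa using hF lj h
            subst this
            exact .empty
          | single l =>
            intro F hF hl
            have hl' : ∀ lj ∈ F, lj.1 = l := fun lj h => by simpa using hl lj h
            have hFe : F = (F.image Prod.snd).image fun j => (l, j) := by
              ext ⟨l', j⟩
              simp only [Finset.mem_image, Prod.exists, exists_eq_right, Prod.mk.injEq,
                exists_eq_right_right]
              constructor
              · intro h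
                exact ⟨⟨l', h⟩, (hl' _ h).symm⟩
              · rintro ⟨⟨l'', h⟩, rfl⟩
                rwa [← hl' _ h]
            rw [hFe]
            refine TreeLike.image (B := fun j => Set.range (A j)) (m := ι l)
              (fun j j' h => (Prod.mk.inj h).2) (ι l).injective (fun j => ?_)
              (hA _ (Finset.card_image_le.trans hF))
            rw [← Set.range_comp]
            rfl
          | @union F₁ F₂ _ _ hd hFF ih₁ ih₂ =>
            intro F hF hmem
            have hsplit : F = F.filter (fun lj => lj.1 ∈ F₁) ∪
                F.filter (fun lj => lj.1 ∈ F₂) := by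
              ext lj
              simp only [Finset.mem_union, Finset.mem_filter]
              have := hmem lj
              rw [Finset.mem_union] at this
              tauto
            rw [hsplit]
            refine .union
              (ih₁ _ ((Finset.card_le_card (Finset.filter_subset _ _)).trans hF) (by simp))
              (ih₂ _ ((Finset.card_le_card (Finset.filter_subset _ _)).trans hF) (by simp)) ?_ ?_
            · rw [Finset.disjoint_left]
              intro lj h h'
              exact Finset.disjoint_left.1 hd (Finset.mem_filter.1 h).2 (Finset.mem_filter.1 h').2
            · simp only [Finset.mem_filter]
              rintro lj₁ ⟨-, h₁⟩ lj₂ ⟨-, h₂⟩ lj₃ ⟨-, h₃⟩ lj₄ ⟨-, h₄⟩ v w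
                ⟨x₁, rfl⟩ ⟨x₂, e⟩ ⟨x₃, rfl⟩ ⟨x₄, e'⟩
              have hne : ∀ l l', l ∈ F₁ → l' ∈ F₂ → l' ≠ l := fun l l' h h' e =>
                Finset.disjoint_left.1 hd h (e ▸ h')
              obtain ⟨p₂, p₁, hm⟩ := ι_meet _ _ _ _ (hne _ _ h₁ h₂) e
              obtain ⟨p₄, p₃, hm'⟩ := ι_meet _ _ _ _ (hne _ _ h₃ h₄) e'
              have := hFF _ h₁ _ h₂ _ h₃ _ h₄ _ _ ⟨_, rfl⟩ ⟨_, hm⟩ ⟨_, rfl⟩ ⟨_, hm'⟩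
              change ι lj₁.1 (A lj₁.2 x₁) = ι lj₃.1 (A lj₃.2 x₃)
              rw [ι_eq, ι_eq, dif_pos p₁, dif_pos p₃, this]
        exact aux _ (hM _ hcard) F hF fun lj h => Finset.mem_image_of_mem _ h
      · have hinj : Set.InjOn Prod.fst (↑F : Set (L × J)) := by
          rw [← Finset.card_image_iff]
          exact le_antisymm Finset.card_image_le (by omega)
        refine TreeLike.of_subsingleton_inter F ?_
        rintro lj hj li hi lk hk hij hkj v w ⟨x₁, rfl⟩ ⟨x₂, e⟩ ⟨x₃, rfl⟩ ⟨x₄, e'⟩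
        obtain ⟨-, p₁, -⟩ := ι_meet _ _ _ _ (fun h => hij (hinj hi hj h)) e
        obtain ⟨-, p₃, -⟩ := ι_meet _ _ _ _ (fun h => hkj (hinj hk hj h)) e'
        rw [hπ _ _ _ (p₁.trans p₃.symm)]
    · rintro ⟨l, j⟩ x y h
      have hι : ∀ v, Sum.elim (fun _ => p) (fun lv : L × V => π lv.2) (ι l v) = π v := by
        intro v
        rw [ι_eq]
        split_ifs with h
        · exact h.symm
        · rfl
      exact hπ j x y (by rw [← hι, ← hι (A j y)]; exact h)
    · intro χ
      have hι : ∀ l v, Sum.elim (fun _ => p) (fun lv : L × V => π lv.2) (ι l v) = π v := by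
        intro l v
        rw [ι_eq]
        split_ifs with h
        · exact h.symm
        · rfl
      obtain ⟨l, i, hl⟩ := hMχ fun y => χ (.inl y)
      obtain ⟨col, hcol⟩ := hχ fun v => χ (ι l v)
      refine ⟨Function.update col p i, fun β => ?_⟩
      obtain ⟨j, hj, hj'⟩ := hcol β
      refine ⟨(l, j), fun x => (hι l _).trans (hj x), fun x hx => ?_⟩
      by_cases hp : β x = p
      · have : π (A j x) = p := (hj x).trans hp
        rw [hp, Function.update_self, ← hl ⟨A j x, this⟩]
        change χ (ι l (A j x)) = _
        rw [ι_eq, dif_pos this]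
      · rw [Function.update_of_ne hp]
        exact hj' x ((Finset.mem_insert.1 hx).resolve_left hp)

theorem exists_sparse {q : ℕ} (hq : 0 < q) (s : ℕ) (κ : Type) [Fintype κ] :
    ∃ (V J : Type) (_ : Fintype V) (_ : Fintype J) (_ : DecidableEq J) (A : J → κ ↪ V),
      Sparse s A ∧ ∀ χ : V → Fin q, ∃ j i, ∀ x, χ (A j x) = i := by
  classical
  induction s generalizing κ with
  | zero =>
    obtain ⟨P, _, hP⟩ := Fintype.exists_mono_embedding q κ
    refine ⟨P, κ ↪ P, inferInstance, inferInstance, inferInstance, id, fun F hF => ?_, hP⟩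
    have : F = ∅ := Finset.card_eq_zero.1 (Nat.le_zero.1 hF)
    subst this
    exact .empty
  | succ s ih =>
    obtain ⟨P, _, hP⟩ := Fintype.exists_mono_embedding q κ
    obtain ⟨V, J, _, _, _, A, π, hA, -, hχ⟩ :=
      exists_sparse_partite κ hq s (fun κ' _ => ih κ') P Finset.univ
    refine ⟨V, J, inferInstance, inferInstance, inferInstance, A, hA, fun χ => ?_⟩
    obtain ⟨col, hcol⟩ := hχ χ
    obtain ⟨β, i, hβ⟩ := hP col
    obtain ⟨j, -, hj⟩ := hcol β
    exact ⟨j, i, fun x => (hj x (Finset.mem_univ _)).trans (hβ x)⟩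

/-! ### Gluing star gadgets along a sparse hypergraph -/

open Classical in
/-- The map of the `j`-th copy of a star gadget into the union of all of them: the roots are all
identified, and the terminal `x` is identified with the vertex `A j x` when `(j, x) ∈ P`. -/
noncomputable def starMapFun {W V J κ : Type} (u : W) (t : κ ↪ W) (A : J → κ ↪ V)
    (P : Finset (J × κ)) (j : J) (w : W) : Option (V ⊕ J × W) :=
  if w = u then none
  else if h : ∃ x, (j, x) ∈ P ∧ t x = w then some (.inl (A j h.choose)) else some (.inr (j, w))

section StarMap

variable {W V J κ : Type} {u : W} {t : κ ↪ W} {A : J → κ ↪ V}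
  {P : Finset (J × κ)} {j : J}

theorem starMapFun_root : starMapFun u t A P j u = none := if_pos rfl

theorem starMapFun_terminal (ht : ∀ x, t x ≠ u) {x : κ} (h : (j, x) ∈ P) :
    starMapFun u t A P j (t x) = some (.inl (A j x)) := by
  have hex : ∃ y, (j, y) ∈ P ∧ t y = t x := ⟨x, h, rfl⟩
  rw [starMapFun, if_neg (ht x), dif_pos hex, t.injective hex.choose_spec.2]

theorem starMapFun_free (ht : ∀ x, t x ≠ u) {x : κ} (h : (j, x) ∉ P) :
    starMapFun u t A P j (t x) = some (.inr (j, t x)) := by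
  rw [starMapFun, if_neg (ht x), dif_neg]
  rintro ⟨y, hy, hyx⟩
  exact h (t.injective hyx ▸ hy)

theorem starMapFun_eq_none {w : W} (h : starMapFun u t A P j w = none) : w = u := by
  by_contra hw
  rw [starMapFun, if_neg hw] at h
  split_ifs at h

theorem starMapFun_eq_inl {w : W} {v : V} (h : starMapFun u t A P j w = some (.inl v)) :
    ∃ x, (j, x) ∈ P ∧ w = t x ∧ A j x = v := by
  rw [starMapFun] at h
  split_ifs at h with hw hex
  · exact ⟨hex.choose, hex.choose_spec.1, hex.choose_spec.2.symm,
      Sum.inl_injective (Option.some_injective _ h)⟩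
  · simp at h

theorem starMapFun_eq_inr {w w' : W} {i : J}
    (h : starMapFun u t A P j w = some (.inr (i, w'))) : j = i ∧ w = w' := by
  rw [starMapFun] at h
  split_ifs at h with hw hex
  · simp at h
  · simpa using h

end StarMap

/-- `starMapFun` as an embedding. -/
noncomputable def starMap {W V J κ : Type} (u : W) (t : κ ↪ W) (A : J → κ ↪ V)
    (P : Finset (J × κ)) (j : J) : W ↪ Option (V ⊕ J × W) where
  toFun := starMapFun u t A P j
  inj' := by
    intro w w' h
    match h' : starMapFun u t A P j w' with
    | none => rw [starMapFun_eq_none h', starMapFun_eq_none (h.trans h')]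
    | some (.inl v) =>
      obtain ⟨x, -, hx, hv⟩ := starMapFun_eq_inl h'
      obtain ⟨x', -, hx', hv'⟩ := starMapFun_eq_inl (h.trans h')
      rw [hx, hx', (A j).injective (hv.trans hv'.symm)]
    | some (.inr (i, v)) =>
      rw [(starMapFun_eq_inr h').2, (starMapFun_eq_inr (h.trans h')).2]

/-- The star joining the root to all vertices of the hypergraph. -/
def rootStar (V I : Type) : SimpleGraph (Option (V ⊕ I)) :=
  fromRel fun x y => x = none ∧ ∃ v, y = some (.inl v)

/-- The union of the star gadgets with underlying graph `G`, glued along the hypergraph `A`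
at the incidences in `P`. -/
noncomputable def starUnion {W V J κ : Type} (G : SimpleGraph W) (u : W) (t : κ ↪ W)
    (A : J → κ ↪ V) (P : Finset (J × κ)) : SimpleGraph (Option (V ⊕ J × W)) :=
  rootStar V (J × W) ⊔ ⨆ j, G.map (starMap u t A P j)

theorem rootStar_adj {V I : Type} {x y : Option (V ⊕ I)} : (rootStar V I).Adj x y ↔
    (x = none ∧ ∃ v, y = some (.inl v)) ∨ (y = none ∧ ∃ v, x = some (.inl v)) := by
  rw [rootStar, fromRel_adj]
  constructor
  · exact fun h => h.2
  · rintro (⟨rfl, v, rfl⟩ | ⟨rfl, v, rfl⟩) <;> simp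

theorem iSup_map_adj {ι W U : Type} {G : SimpleGraph W} {m : ι → W ↪ U} {x y : U} :
    (⨆ i, G.map (m i)).Adj x y ↔ ∃ i a b, G.Adj a b ∧ m i a = x ∧ m i b = y := by
  simp only [iSup_adj, map_adj]

theorem IsCopy.of_starUnion {VH W V J κ : Type} [Fintype VH] [DecidableEq J]
    {H : SimpleGraph VH} (hH : Robust H) {G : SimpleGraph W} {u : W} {t : κ ↪ W}
    (hadj : ∀ x, G.Adj u (t x)) {A : J → κ ↪ V} (hA : Sparse (Fintype.card (Sym2 VH)) A)
    {P : Finset (J × κ)} {f : VH ↪ Option (V ⊕ J × W)}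
    (hf : IsCopy H (starUnion G u t A P) f) :
    ∃ j, IsCopy H (G.map (starMap u t A P j)) f := by
  classical
  have ht : ∀ x, t x ≠ u := fun x => (hadj x).ne'
  have hstar : ∀ a b, H.Adj a b → f a = none → (∃ v, f b = some (.inl v)) →
      (⨆ j, G.map (starMap u t A P j)).Adj (f a) (f b) := by
    rintro a b hab ha ⟨v, hv⟩
    obtain ⟨b', hb, hne⟩ := hH.exists_adj_ne b a
    have hb' : f b' ≠ none := fun h => hne (f.injective (h.trans ha.symm))
    rcases hf b b' hb with h | h
    · rw [rootStar_adj, hv] at h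
      simp [hb'] at h
    · obtain ⟨j, w, w', -, hw, -⟩ := iSup_map_adj.1 h
      obtain ⟨x, hx, rfl, rfl⟩ := starMapFun_eq_inl (hw.trans hv)
      rw [iSup_map_adj, ha, ← hw]
      exact ⟨j, u, t x, hadj x, starMapFun_root, rfl⟩
  have hf' : IsCopy H (⨆ j, G.map (starMap u t A P j)) f := by
    intro a b hab
    rcases hf a b hab with h | h
    · rcases rootStar_adj.1 h with ⟨h1, h2⟩ | ⟨h1, h2⟩
      · exact hstar a b hab h1 h2
      · exact (hstar b a hab.symm h1 h2).symm
    · exact h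
  have hchoice : ∀ s : Sym2 VH, ∃ j : Option J, ∀ a b, s = s(a, b) → H.Adj a b →
      ∃ j', j = some j' ∧ (G.map (starMap u t A P j')).Adj (f a) (f b) := by
    intro s
    induction s with | _ a b
    by_cases hab : H.Adj a b
    · obtain ⟨j, hj⟩ := iSup_adj.1 (hf' a b hab)
      refine ⟨some j, fun a' b' h _ => ⟨j, rfl, ?_⟩⟩
      rcases Sym2.eq_iff.1 h with ⟨rfl, rfl⟩ | ⟨rfl, rfl⟩
      exacts [hj, hj.symm]
    · refine ⟨none, fun a' b' h hab' => (hab ?_).elim⟩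
      rcases Sym2.eq_iff.1 h with ⟨rfl, rfl⟩ | ⟨rfl, rfl⟩
      exacts [hab', hab'.symm]
  choose g hg using hchoice
  set F : Finset J := (Finset.univ.image g).eraseNone with hF
  have hFcard : F.card ≤ Fintype.card (Sym2 VH) := by
    refine le_trans ?_ (Finset.card_image_le (s := Finset.univ) (f := g))
    rw [← Finset.card_map Function.Embedding.some, hF, Finset.map_some_eraseNone]
    exact Finset.card_le_card (Finset.erase_subset _ _)
  have aux : ∀ F : Finset J, TreeLike (fun j => Set.range (A j)) F →
      IsCopy H (⨆ j : {j // j ∈ F}, G.map (starMap u t A P j)) f →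
      ∃ j, IsCopy H (G.map (starMap u t A P j)) f := by
    intro F hF
    induction hF with
    | empty =>
      intro h
      obtain ⟨a⟩ := hH.nonempty
      obtain ⟨b, hab⟩ := hH.exists_adj a
      obtain ⟨⟨j, hj⟩, -⟩ := iSup_adj.1 (h a b hab)
      simp at hj
    | single j =>
      intro h
      refine ⟨j, fun a b hab => ?_⟩
      obtain ⟨⟨j', hj⟩, h'⟩ := iSup_adj.1 (h a b hab)
      rw [Finset.mem_singleton] at hj
      exact hj ▸ h'
    | @union F₁ F₂ _ _ hd hFF ih₁ ih₂ =>
      intro h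
      have hsup : IsCopy H ((⨆ j : {j // j ∈ F₁}, G.map (starMap u t A P j)) ⊔
          (⨆ j : {j // j ∈ F₂}, G.map (starMap u t A P j))) f := by
        intro a b hab
        obtain ⟨⟨j, hj⟩, h'⟩ := iSup_adj.1 (h a b hab)
        rcases Finset.mem_union.1 hj with hj | hj
        · exact .inl (iSup_adj.2 ⟨⟨j, hj⟩, h'⟩)
        · exact .inr (iSup_adj.2 ⟨⟨j, hj⟩, h'⟩)
      let S : Finset J → Set (Option (V ⊕ J × W)) := fun F =>
        {y | ∃ j ∈ F, ∃ w, starMap u t A P j w = y}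
      have hS : ∀ F : Finset J, ∀ x y,
          (⨆ j : {j // j ∈ F}, G.map (starMap u t A P j)).Adj x y → x ∈ S F := by
        intro F x y h
        obtain ⟨⟨j, hj⟩, w, w', -, hw, -⟩ := iSup_map_adj.1 h
        exact ⟨j, hj, w, hw⟩
      have hmeet : ∀ y ∈ S F₁, y ∈ S F₂ → y = none ∨ ∃ v, y = some (.inl v) ∧
          (∃ j ∈ F₁, v ∈ Set.range (A j)) ∧ ∃ j ∈ F₂, v ∈ Set.range (A j) := by
        rintro y ⟨j₁, h₁, w₁, e₁⟩ ⟨j₂, h₂, w₂, e₂⟩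
        match y with
        | none => exact .inl rfl
        | some (.inl v) =>
          obtain ⟨x₁, -, -, hx₁⟩ := starMapFun_eq_inl e₁
          obtain ⟨x₂, -, -, hx₂⟩ := starMapFun_eq_inl e₂
          exact .inr ⟨v, rfl, ⟨j₁, h₁, x₁, hx₁⟩, j₂, h₂, x₂, hx₂⟩
        | some (.inr (i, w)) =>
          obtain rfl := (starMapFun_eq_inr e₁).1
          obtain rfl := (starMapFun_eq_inr e₂).1
          exact (Finset.disjoint_left.1 hd h₁ h₂).elim
      have hroot : ∀ F : Finset J, ∀ v, some (.inl v) ∈ S F →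
          (⨆ j : {j // j ∈ F}, G.map (starMap u t A P j)).Adj none (some (.inl v)) := by
        rintro F v ⟨j, hj, w, hw⟩
        obtain ⟨x, hx, rfl, rfl⟩ := starMapFun_eq_inl hw
        exact iSup_map_adj.2 ⟨⟨j, hj⟩, u, t x, hadj x, starMapFun_root, hw⟩
      have : ∃ z, (∀ y ∈ S F₁, y ∈ S F₂ → y = none ∨ y = z) ∧
          ((⨆ j : {j // j ∈ F₁}, G.map (starMap u t A P j)).Adj none z ↔
            (⨆ j : {j // j ∈ F₂}, G.map (starMap u t A P j)).Adj none z) := by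
        by_cases hex : ∃ v, some (.inl v) ∈ S F₁ ∧ some (.inl v) ∈ S F₂
        · obtain ⟨v, hv₁, hv₂⟩ := hex
          refine ⟨some (.inl v), fun y hy₁ hy₂ => ?_, fun _ => hroot _ _ hv₂,
            fun _ => hroot _ _ hv₁⟩
          refine (hmeet y hy₁ hy₂).imp_right ?_
          rintro ⟨v', rfl, ⟨j₁, h₁, h₁'⟩, j₂, h₂, h₂'⟩
          obtain h | ⟨w, hw, ⟨k₁, h₃, h₃'⟩, k₂, h₄, h₄'⟩ := hmeet _ hv₁ hv₂
          · cases h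
          · obtain rfl : v = w := by simpa using hw
            rw [hFF j₁ h₁ j₂ h₂ k₁ h₃ k₂ h₄ v' v h₁' h₂' h₃' h₄']
        · refine ⟨none, fun y hy₁ hy₂ => ?_, by simp only [SimpleGraph.irrefl]⟩
          obtain h | ⟨v, rfl, -⟩ := hmeet y hy₁ hy₂
          · exact .inl h
          · exact (hex ⟨v, hy₁, hy₂⟩).elim
      obtain ⟨z, hz, hz'⟩ := this
      rcases hsup.of_sup hH (hS F₁) (hS F₂) hz hz' with h' | h'
      exacts [ih₁ h', ih₂ h']
  refine aux F (hA F hFcard) fun a b hab => ?_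
  obtain ⟨j, hj, h⟩ := hg s(a, b) a b rfl hab
  refine iSup_adj.2 ⟨⟨j, ?_⟩, h⟩
  rw [hF, Finset.mem_eraseNone, ← hj]
  exact Finset.mem_image_of_mem _ (Finset.mem_univ _)

/-- The `H`-free colourings of a union of star gadgets restrict to `H`-free colourings of the
gadgets. -/
theorem StarGadget.restrict {VH W V J κ : Type} {q : ℕ} {H : SimpleGraph VH}
    {G : SimpleGraph W} {u : W} {t : κ ↪ W} {A : J → κ ↪ V} {P : Finset (J × κ)}
    {c : Sym2 (Option (V ⊕ J × W)) → Fin q} (hc : ¬ HasMonoCopy (starUnion G u t A P) H c)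
    (j : J) : ¬ HasMonoCopy G H fun s => c (s.map (starMap u t A P j)) := fun h =>
  hc (h.map.mono (le_sup_of_le_right (le_iSup (fun j => G.map (starMap u t A P j)) j))
    fun _ _ _ => rfl)

/-- Compatible `H`-free colourings of the gadgets yield an `H`-free colouring of their union. -/
theorem StarGadget.not_isRamsey_starUnion {VH W V J κ : Type} [Fintype VH] [DecidableEq J]
    {q : ℕ} (hq : 0 < q) {H : SimpleGraph VH} (hH : Robust H) {G : SimpleGraph W} {u : W}
    {t : κ ↪ W} (hG : StarGadget q H G u t) {A : J → κ ↪ V}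
    (hA : Sparse (Fintype.card (Sym2 VH)) A) {P : Finset (J × κ)} (χ : V → Fin q)
    (hχ : ∀ j, ∃ c : Sym2 W → Fin q, ¬ HasMonoCopy G H c ∧
      ∀ x, (j, x) ∈ P → c s(u, t x) = χ (A j x)) :
    ¬ IsRamsey q (starUnion G u t A P) H := by
  classical
  choose c hc hcχ using hχ
  have ht : ∀ x, t x ≠ u := fun x => (hG.adj x).ne'
  have hcard : 2 ≤ Fintype.card (Sym2 VH) := by
    obtain ⟨a⟩ := hH.nonempty
    obtain ⟨b, hab⟩ := hH.exists_adj a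
    have : s(a, b) ≠ s(a, a) := fun h => hab.ne (Sym2.congr_right.1 h).symm
    exact Fintype.one_lt_card_iff.2 ⟨_, _, this⟩
  have hlin : ∀ i j, i ≠ j → ∀ v w, v ∈ Set.range (A i) → v ∈ Set.range (A j) →
      w ∈ Set.range (A i) → w ∈ Set.range (A j) → v = w := fun i j =>
    (hA {i, j} (Finset.card_le_two.trans hcard)).linear i (by simp) j (by simp)
  -- the colour of an edge of a gadget does not depend on the gadget
  have huniq : ∀ i j a b a' b', i ≠ j → G.Adj a b → G.Adj a' b' →
      starMap u t A P i a = starMap u t A P j a' → starMap u t A P i b = starMap u t A P j b' →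
      c i s(a, b) = c j s(a', b') := by
    have hinl : ∀ i j a a' v, i ≠ j → starMap u t A P i a = starMap u t A P j a' →
        starMap u t A P j a' = v → v = none ∨ ∃ w, v = some (.inl w) := by
      intro i j a a' v hij h h'
      match v with
      | none => exact .inl rfl
      | some (.inl w) => exact .inr ⟨w, rfl⟩
      | some (.inr (k, w)) =>
        exact absurd ((starMapFun_eq_inr (h.trans h')).1.trans (starMapFun_eq_inr h').1.symm) hij
    have hroot : ∀ i j a b a' b', i ≠ j → G.Adj a b →
        starMap u t A P i a = starMap u t A P j a' → starMap u t A P i b = starMap u t A P j b' →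
        starMap u t A P j a' = none → c i s(a, b) = c j s(a', b') := by
      intro i j a b a' b' hij hab h h' hn
      obtain rfl := starMapFun_eq_none hn
      obtain rfl := starMapFun_eq_none (h.trans hn)
      obtain hb | ⟨w, hw⟩ := hinl i j b b' _ hij h' rfl
      · exact absurd (starMapFun_eq_none (h'.trans hb)).symm hab.ne
      · obtain ⟨x, hx, rfl, rfl⟩ := starMapFun_eq_inl hw
        obtain ⟨x', hx', rfl, hx''⟩ := starMapFun_eq_inl (h'.trans hw)
        rw [hcχ _ _ hx, hcχ _ _ hx', hx'']
    intro i j a b a' b' hij hab hab' ha hb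
    obtain hn | ⟨v, hv⟩ := hinl i j a a' _ hij ha rfl
    · exact hroot i j a b a' b' hij hab ha hb hn
    obtain hn | ⟨w, hw⟩ := hinl i j b b' _ hij hb rfl
    · rw [Sym2.eq_swap, @Sym2.eq_swap _ a' b']
      exact hroot i j b a b' a' hij hab.symm hb ha hn
    · obtain ⟨x, -, -, hx⟩ := starMapFun_eq_inl hv
      obtain ⟨x', -, -, hx'⟩ := starMapFun_eq_inl (ha.trans hv)
      obtain ⟨y, -, -, hy⟩ := starMapFun_eq_inl hw
      obtain ⟨y', -, -, hy'⟩ := starMapFun_eq_inl (hb.trans hw)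
      have := hlin i j hij v w ⟨x', hx'⟩ ⟨x, hx⟩ ⟨y', hy'⟩ ⟨y, hy⟩
      rw [this, ← hw] at hv
      exact absurd ((starMap u t A P j).injective hv) hab'.ne
  obtain ⟨d, hd⟩ := exists_colouring hq
    (fun x y i => ∃ j a b, G.Adj a b ∧ starMap u t A P j a = x ∧ starMap u t A P j b = y ∧
      c j s(a, b) = i)
    (fun x y i ⟨j, a, b, hab, ha, hb, hi⟩ => ⟨j, b, a, hab.symm, hb, ha, Sym2.eq_swap ▸ hi⟩)
    (by
      rintro x y k k' ⟨j, a, b, hab, rfl, rfl, rfl⟩ ⟨j', a', b', hab', ha, hb, rfl⟩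
      by_cases hj : j' = j
      · subst hj
        rw [(starMap u t A P j').injective ha, (starMap u t A P j').injective hb]
      · exact (huniq _ _ _ _ _ _ hj hab' hab ha hb).symm)
  refine fun hR => ?_
  obtain ⟨i, f, hf⟩ := hR d
  obtain ⟨j, hj⟩ := IsCopy.of_starUnion hH hG.adj hA fun a b hab => (hf a b hab).1
  have hmono : HasMonoCopy (G.map (starMap u t A P j)) H d :=
    ⟨i, f, fun a b hab => ⟨hj a b hab, (hf a b hab).2⟩⟩
  refine hc j ((HasMonoCopy.of_map hH hmono).mono le_rfl fun x y hxy => ?_)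
  exact (hd _ _ _ ⟨j, x, y, hxy, rfl, rfl, rfl⟩).symm

theorem starUnion_adj_root {W V J κ : Type} (G : SimpleGraph W) (u : W) (t : κ ↪ W)
    (A : J → κ ↪ V) (P : Finset (J × κ)) (v : V) :
    (starUnion G u t A P).Adj none (some (.inl v)) :=
  .inl (rootStar_adj.2 (.inl ⟨rfl, v, rfl⟩))

theorem starUnion_adj_map {W V J κ : Type} {G : SimpleGraph W} {u : W} {t : κ ↪ W}
    {A : J → κ ↪ V} {P : Finset (J × κ)} (j : J) {a b : W} (h : G.Adj a b) :
    (starUnion G u t A P).Adj (starMap u t A P j a) (starMap u t A P j b) :=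
  .inr (iSup_map_adj.2 ⟨j, a, b, h, rfl, rfl⟩)

/-- If every colouring of the vertices has a monochromatic hyperedge, the union of the gadgets
is a Ramsey graph. -/
theorem StarGadget.isRamsey_starUnion {VH W V J κ : Type} [Fintype J] [Fintype κ]
    {q : ℕ} {H : SimpleGraph VH} {G : SimpleGraph W} {u : W}
    {t : κ ↪ W} (hG : StarGadget q H G u t) {A : J → κ ↪ V}
    (hA : ∀ χ : V → Fin q, ∃ j i, ∀ x, χ (A j x) = i) :
    IsRamsey q (starUnion G u t A Finset.univ) H := by
  intro c
  by_contra hc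
  obtain ⟨j, i, hi⟩ := hA fun v => c s(none, some (.inl v))
  refine hG.not_mono _ (StarGadget.restrict hc j) ⟨i, fun x => ?_⟩
  rw [← hi x]
  change c s(starMapFun u t A Finset.univ j u, starMapFun u t A Finset.univ j (t x)) = _
  rw [starMapFun_root, starMapFun_terminal (fun x => (hG.adj x).ne') (Finset.mem_univ _)]

/-- A star gadget with two terminals exists. -/
theorem exists_starGadget_two {VH : Type} [Fintype VH] {H : SimpleGraph VH} (hH : Robust H)
    {q : ℕ} (hq : 2 ≤ q) : ∃ (W : Type) (_ : Fintype W) (G : SimpleGraph W)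
      (u : W) (t : Fin 2 ↪ W), StarGadget q H G u t := by
  classical
  obtain ⟨W, κ, _, _, G, u, t, hG⟩ := exists_starGadget hH hq
  have ht : ∀ x, t x ≠ u := fun x => (hG.adj x).ne'
  obtain ⟨V, J, _, _, _, A, hA, hχ⟩ :=
    exists_sparse (q := q) (by omega) (Fintype.card (Sym2 VH)) κ
  obtain ⟨c₀, hc₀⟩ := not_forall.1 hG.not_ramsey
  obtain ⟨P, ⟨j, x⟩, hjx, hP, hP'⟩ := Finset.exists_insert_step
    (fun P : Finset (J × κ) => ¬ IsRamsey q (starUnion G u t A P) H)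
    (hG.not_isRamsey_starUnion (by omega) hH hA (fun _ => ⟨0, by omega⟩)
      fun j => ⟨c₀, hc₀, by simp⟩)
    (not_not.2 (hG.isRamsey_starUnion hχ))
  have hne : (some (.inr (j, t x)) : Option (V ⊕ J × W)) ≠ some (.inl (A j x)) := by simp
  refine ⟨Option (V ⊕ J × W), inferInstance, starUnion G u t A P, none,
    ⟨![some (.inr (j, t x)), some (.inl (A j x))], ?_⟩, ?_, hP, ?_⟩
  · intro a b
    fin_cases a <;> fin_cases b <;> simp
  · intro a
    fin_cases a
    · have := starUnion_adj_map (u := u) (t := t) (A := A) (P := P) j (hG.adj x)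
      change (starUnion G u t A P).Adj (starMapFun u t A P j u) (starMapFun u t A P j (t x)) at this
      rw [starMapFun_root, starMapFun_free ht hjx] at this
      exact this
    · exact starUnion_adj_root G u t A P (A j x)
  · rintro c hc ⟨i, hi⟩
    refine hP' (hG.not_isRamsey_starUnion (by omega) hH hA
      (fun v => c s(none, some (.inl v))) fun j' =>
        ⟨_, StarGadget.restrict hc j', fun x' hx' => ?_⟩)
    change c s(starMapFun u t A P j' u, starMapFun u t A P j' (t x')) = _
    by_cases h : (j', x') ∈ P
    · rw [starMapFun_root, starMapFun_terminal ht h]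
    · obtain ⟨rfl, rfl⟩ : j' = j ∧ x' = x := by
        simpa [h] using hx'
      rw [starMapFun_root, starMapFun_free ht h]
      exact (hi 0).trans (hi 1).symm

/-- There is a graph with an `H`-free colouring and two adjacent edges that have the same colour
in every `H`-free colouring. -/
theorem exists_adjacent_sender {VH : Type} [Fintype VH] {H : SimpleGraph VH} (hH : Robust H)
    {q : ℕ} (hq : 2 ≤ q) : ∃ (W : Type) (_ : Fintype W) (G : SimpleGraph W) (u x y : W),
      x ≠ y ∧ G.Adj u x ∧ G.Adj u y ∧ ¬ IsRamsey q G H ∧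
      ∀ c : Sym2 W → Fin q, ¬ HasMonoCopy G H c → c s(u, x) = c s(u, y) := by
  classical
  obtain ⟨W, _, G, u, t, hG⟩ := exists_starGadget_two hH hq
  have ht : ∀ x, t x ≠ u := fun x => (hG.adj x).ne'
  obtain ⟨V, J, _, _, _, A, hA, hχ⟩ :=
    exists_sparse (q := q) (by omega) (Fintype.card (Sym2 VH)) (Fin 2)
  obtain ⟨c₀, hc₀⟩ := not_forall.1 hG.not_ramsey
  have hc₀ne : c₀ s(u, t 0) ≠ c₀ s(u, t 1) := fun h =>
    hG.not_mono c₀ hc₀ ⟨_, Fin.forall_fin_two.2 ⟨rfl, h.symm⟩⟩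
  have hall : ∀ a b : Fin q, a ≠ b → ∃ c : Sym2 W → Fin q, ¬ HasMonoCopy G H c ∧
      c s(u, t 0) = a ∧ c s(u, t 1) = b := by
    intro a b hab
    let τ := Equiv.swap (c₀ s(u, t 0)) a
    let σ := Equiv.swap (τ (c₀ s(u, t 1))) b
    have hτ : τ (c₀ s(u, t 0)) = a := Equiv.swap_apply_left _ _
    refine ⟨fun s => (τ.trans σ) (c₀ s), fun h => hc₀ (h.of_perm _), ?_, ?_⟩
    · change σ (τ _) = a
      rw [hτ]
      exact Equiv.swap_apply_of_ne_of_ne (fun h => hc₀ne (τ.injective (hτ.trans h))) hab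
    · exact Equiv.swap_apply_left _ _
  obtain ⟨F, j, hj, hF, hF'⟩ := Finset.exists_insert_step
    (fun F : Finset J => ¬ IsRamsey q (starUnion G u t A (F ×ˢ Finset.univ)) H)
    (hG.not_isRamsey_starUnion (by omega) hH hA (fun _ => ⟨0, by omega⟩)
      fun j => ⟨c₀, hc₀, by simp⟩)
    (by rw [Finset.univ_product_univ]; exact not_not.2 (hG.isRamsey_starUnion hχ))
  refine ⟨Option (V ⊕ J × W), inferInstance, starUnion G u t A (F ×ˢ Finset.univ), none,
    some (.inl (A j 0)), some (.inl (A j 1)), by simp, starUnion_adj_root .., starUnion_adj_root ..,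
    hF, fun c hc => ?_⟩
  by_contra hne
  refine hF' (hG.not_isRamsey_starUnion (by omega) hH hA
    (fun v => c s(none, some (.inl v))) fun j' => ?_)
  by_cases h : j' = j
  · subst h
    obtain ⟨c', hc', h0, h1⟩ := hall _ _ hne
    refine ⟨c', hc', fun x _ => ?_⟩
    fin_cases x
    exacts [h0, h1]
  · refine ⟨_, StarGadget.restrict hc j', fun x hx => ?_⟩
    change c s(starMapFun u t A _ j' u, starMapFun u t A _ j' (t x)) = _
    rw [starMapFun_root, starMapFun_terminal ht]
    simpa [h] using hx

/-! ### Gluing two graphs -/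

/-- The inclusion of `W` into `V ⊕ W`, redirected to `V` wherever the partial map `t` is defined. -/
def attach {V W : Type*} (t : W → Option V)
    (ht : ∀ w w' v, t w = some v → t w' = some v → w = w') : W ↪ V ⊕ W where
  toFun w := (t w).elim (.inr w) .inl
  inj' := by
    intro w w' h
    match e : t w, e' : t w' with
    | none, none => simpa [e, e'] using h
    | none, some v => simp [e, e'] at h
    | some v, none => simp [e, e'] at h
    | some v, some v' =>
      obtain rfl : v = v' := by simpa [e, e'] using h
      exact ht w w' v e e'

theorem attach_some {V W : Type*} {t : W → Option V}
    {ht : ∀ w w' v, t w = some v → t w' = some v → w = w'} {w : W} {v : V} (h : t w = some v) :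
    attach t ht w = .inl v := by
  change (t w).elim (Sum.inr w) Sum.inl = _
  rw [h, Option.elim_some]

theorem attach_none {V W : Type*} {t : W → Option V}
    {ht : ∀ w w' v, t w = some v → t w' = some v → w = w'} {w : W} (h : t w = none) :
    attach t ht w = .inr w := by
  change (t w).elim (Sum.inr w) Sum.inl = _
  rw [h, Option.elim_none]

theorem attach_eq_inl {V W : Type*} {t : W → Option V}
    {ht : ∀ w w' v, t w = some v → t w' = some v → w = w'} {w : W} {v : V}
    (h : attach t ht w = .inl v) : t w = some v := by
  change (t w).elim (Sum.inr w) Sum.inl = Sum.inl v at h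
  match e : t w with
  | none => simp [e] at h
  | some v' => simpa [e] using h

theorem exists_glued_colouring {V W U : Type*} {q : ℕ} (hq : 0 < q) {G : SimpleGraph V}
    {S : SimpleGraph W} (m : V ↪ U) (m' : W ↪ U) (c : Sym2 V → Fin q) (c' : Sym2 W → Fin q)
    (h : ∀ a b a' b', G.Adj a b → S.Adj a' b' → m a = m' a' → m b = m' b' →
      c s(a, b) = c' s(a', b')) :
    ∃ d : Sym2 U → Fin q, (∀ a b, G.Adj a b → d s(m a, m b) = c s(a, b)) ∧
      ∀ a b, S.Adj a b → d s(m' a, m' b) = c' s(a, b) := by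
  obtain ⟨d, hd⟩ := exists_colouring hq
    (fun x y i => (∃ a b, G.Adj a b ∧ m a = x ∧ m b = y ∧ c s(a, b) = i) ∨
      ∃ a b, S.Adj a b ∧ m' a = x ∧ m' b = y ∧ c' s(a, b) = i)
    (by
      rintro x y i (⟨a, b, hab, ha, hb, hi⟩ | ⟨a, b, hab, ha, hb, hi⟩)
      · exact .inl ⟨b, a, hab.symm, hb, ha, Sym2.eq_swap ▸ hi⟩
      · exact .inr ⟨b, a, hab.symm, hb, ha, Sym2.eq_swap ▸ hi⟩)
    (by
      rintro x y i j (⟨a, b, hab, rfl, rfl, rfl⟩ | ⟨a, b, hab, rfl, rfl, rfl⟩)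
        (⟨a', b', hab', ha, hb, rfl⟩ | ⟨a', b', hab', ha, hb, rfl⟩)
      · rw [m.injective ha, m.injective hb]
      · exact h _ _ _ _ hab hab' ha.symm hb.symm
      · exact (h _ _ _ _ hab' hab ha hb).symm
      · rw [m'.injective ha, m'.injective hb])
  exact ⟨d, fun a b hab => hd _ _ _ (.inl ⟨a, b, hab, rfl, rfl, rfl⟩),
    fun a b hab => hd _ _ _ (.inr ⟨a, b, hab, rfl, rfl, rfl⟩)⟩

theorem not_hasMonoCopy_sup_map {VH V W U : Type*} [Fintype VH] {q : ℕ} {H : SimpleGraph VH}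
    (hH : Robust H) {G : SimpleGraph V} {S : SimpleGraph W} {m : V ↪ U} {m' : W ↪ U}
    (hcopy : ∀ f : VH ↪ U, IsCopy H (G.map m ⊔ S.map m') f →
      IsCopy H (G.map m) f ∨ IsCopy H (S.map m') f)
    {c : Sym2 V → Fin q} {c' : Sym2 W → Fin q} {d : Sym2 U → Fin q}
    (hc : ¬ HasMonoCopy G H c) (hc' : ¬ HasMonoCopy S H c')
    (hd : ∀ a b, G.Adj a b → d s(m a, m b) = c s(a, b))
    (hd' : ∀ a b, S.Adj a b → d s(m' a, m' b) = c' s(a, b)) :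
    ¬ HasMonoCopy (G.map m ⊔ S.map m') H d := by
  rintro ⟨i, f, hf⟩
  rcases hcopy f fun a b hab => (hf a b hab).1 with h | h
  · have : HasMonoCopy (G.map m) H d := ⟨i, f, fun a b hab => ⟨h a b hab, (hf a b hab).2⟩⟩
    exact hc ((this.of_map hH).mono le_rfl fun x y hxy => (hd x y hxy).symm)
  · have : HasMonoCopy (S.map m') H d := ⟨i, f, fun a b hab => ⟨h a b hab, (hf a b hab).2⟩⟩
    exact hc' ((this.of_map hH).mono le_rfl fun x y hxy => (hd' x y hxy).symm)

/-! ### Senders whose two edges are far apart -/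

/-- A graph with an `H`-free colouring in which the edges `a₀a₁` and `b₀b₁` have the same colour
in every such colouring. -/
structure Sender (q : ℕ) {VH V : Type*} (H : SimpleGraph VH) (G : SimpleGraph V)
    (a₀ a₁ b₀ b₁ : V) : Prop where
  adj_left : G.Adj a₀ a₁
  adj_right : G.Adj b₀ b₁
  not_ramsey : ¬ IsRamsey q G H
  forced : ∀ c : Sym2 V → Fin q, ¬ HasMonoCopy G H c → c s(a₀, a₁) = c s(b₀, b₁)

theorem Sender.glue {VH V W : Type*} [Fintype VH] {H : SimpleGraph VH} (hH : Robust H) {q : ℕ}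
    (hq : 0 < q) {G : SimpleGraph V} {S : SimpleGraph W} {a₀ a₁ b₀ b₁ : V} {u x y : W}
    (hG : Sender q H G a₀ a₁ b₀ b₁) (hux : S.Adj u x) (huy : S.Adj u y)
    (hS : ¬ IsRamsey q S H)
    (hSf : ∀ c : Sym2 W → Fin q, ¬ HasMonoCopy S H c → c s(u, x) = c s(u, y))
    {m : W ↪ V ⊕ W} (hmu : m u = .inl b₁) (hmx : m x = .inl b₀)
    (hm : ∀ w v, m w = .inl v → w = u ∨ w = x) :
    Sender q H (G.map Function.Embedding.inl ⊔ S.map m) (.inl a₀) (.inl a₁) (m u) (m y) := by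
  refine ⟨.inl (map_adj_apply (f := Function.Embedding.inl).2 hG.adj_left),
    .inr (map_adj_apply.2 huy), ?_, ?_⟩
  · obtain ⟨c, hc⟩ := not_forall.1 hG.not_ramsey
    obtain ⟨c₀, hc₀⟩ := not_forall.1 hS
    let σ := Equiv.swap (c₀ s(u, x)) (c s(b₀, b₁))
    have hσ : σ (c₀ s(u, x)) = c s(b₀, b₁) := Equiv.swap_apply_left _ _
    have hc' : ¬ HasMonoCopy S H fun s => σ (c₀ s) := fun h => hc₀ (h.of_perm _)
    obtain ⟨d, hd, hd'⟩ := exists_glued_colouring hq (G := G) (S := S) Function.Embedding.inl m c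
      (fun s => σ (c₀ s)) (by
        intro a b a' b' hab hab' ha hb
        rcases hm a' a ha.symm with rfl | rfl <;> rcases hm b' b hb.symm with rfl | rfl
        · exact absurd rfl hab'.ne
        · obtain rfl := Sum.inl_injective (ha.trans hmu)
          obtain rfl := Sum.inl_injective (hb.trans hmx)
          rw [hσ, Sym2.eq_swap]
        · obtain rfl := Sum.inl_injective (ha.trans hmx)
          obtain rfl := Sum.inl_injective (hb.trans hmu)
          rw [@Sym2.eq_swap _ a', hσ]
        · exact absurd rfl hab'.ne)
    refine fun hR => not_hasMonoCopy_sup_map hH (fun f hf => ?_) hc hc' hd hd' (hR d)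
    refine hf.of_sup hH (S₁ := Set.range Sum.inl) (S₂ := Set.range m) (u := .inl b₁) (v := .inl b₀)
      ?_ ?_ ?_ ?_
    · rintro _ _ ⟨-, v, w, -, rfl, rfl⟩
      exact ⟨v, rfl⟩
    · rintro _ _ ⟨-, v, w, -, rfl, rfl⟩
      exact ⟨v, rfl⟩
    · rintro _ ⟨v, rfl⟩ ⟨w, hw⟩
      rcases hm w v hw with rfl | rfl
      exacts [.inl (hw.symm.trans hmu), .inr (hw.symm.trans hmx)]
    · refine iff_of_true (map_adj_apply (f := Function.Embedding.inl).2 hG.adj_right.symm) ?_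
      rw [← hmu, ← hmx]
      exact map_adj_apply.2 hux
  · intro c hc
    have h₁ := hG.forced (fun s => c (s.map Sum.inl)) fun h =>
      hc ((HasMonoCopy.map (m := Function.Embedding.inl) h).mono le_sup_left fun _ _ _ => rfl)
    have h₂ := hSf (fun s => c (s.map m)) fun h => hc (h.map.mono le_sup_right fun _ _ _ => rfl)
    change c s(.inl a₀, .inl a₁) = c s(.inl b₀, .inl b₁) at h₁
    change c s(m u, m x) = c s(m u, m y) at h₂
    rw [h₁, ← h₂, hmu, hmx, Sym2.eq_swap]

theorem exists_chain_sender {VH : Type} [Fintype VH] {H : SimpleGraph VH} (hH : Robust H)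
    {q : ℕ} (hq : 2 ≤ q) (n : ℕ) : ∃ (V : Type) (_ : Fintype V) (G : SimpleGraph V)
      (a₀ a₁ b₀ b₁ : V) (l : V → ℕ), Sender q H G a₀ a₁ b₀ b₁ ∧
      (∀ x y, G.Adj x y → l x ≤ l y + 2) ∧ l a₀ = 0 ∧ l a₁ = 1 ∧ l b₀ = n + 1 ∧ l b₁ = n + 2 := by
  classical
  obtain ⟨W, _, S, u, x, y, hxy, hux, huy, hS, hSf⟩ := exists_adjacent_sender hH hq
  induction n with
  | zero =>
    refine ⟨W, inferInstance, S, x, u, u, y, fun w => if w = x then 0 else if w = y then 2 else 1,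
      ⟨hux.symm, huy, hS, fun c hc => ?_⟩, fun v w _ => ?_, ?_, ?_, ?_, ?_⟩
    · rw [Sym2.eq_swap, hSf c hc]
    · dsimp only
      split_ifs <;> omega
    · simp
    · simp [hux.ne, huy.ne]
    · simp [hux.ne, huy.ne]
    · simp [hxy.symm]
  | succ n ih =>
    obtain ⟨V, _, G, a₀, a₁, b₀, b₁, l, hG, hl, ha₀, ha₁, hb₀, hb₁⟩ := ih
    let t : W → Option V := fun w => if w = u then some b₁ else if w = x then some b₀ else none
    have hbb : b₀ ≠ b₁ := hG.adj_right.ne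
    have ht : ∀ w w' v, t w = some v → t w' = some v → w = w' := by
      intro w w' v h h'
      grind
    let m := attach t ht
    have hmu : m u = .inl b₁ := attach_some (by simp [t])
    have hmx : m x = .inl b₀ := attach_some (by simp [t, hux.ne'])
    have hm : ∀ w v, m w = .inl v → w = u ∨ w = x := by
      intro w v h
      have := attach_eq_inl h
      grind
    have hmr : ∀ w, w ≠ u → w ≠ x → m w = .inr w := by
      intro w h h'
      exact attach_none (by simp [t, h, h'])
    let l' : V ⊕ W → ℕ := Sum.elim l fun w => if w = y then n + 3 else n + 2
    have hl' : ∀ w, n + 1 ≤ l' (m w) ∧ l' (m w) ≤ n + 3 := by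
      intro w
      by_cases hwu : w = u
      · rw [hwu, hmu]
        simp only [l', Sum.elim_inl]
        omega
      by_cases hwx : w = x
      · rw [hwx, hmx]
        simp only [l', Sum.elim_inl]
        omega
      rw [hmr w hwu hwx]
      simp only [l', Sum.elim_inr]
      split_ifs <;> omega
    refine ⟨V ⊕ W, inferInstance, _, _, _, _, _, l',
      hG.glue hH (by omega) hux huy hS hSf hmu hmx hm, ?_, ha₀, ha₁, ?_, ?_⟩
    · rintro v w (⟨-, v', w', h, rfl, rfl⟩ | ⟨-, v', w', h, rfl, rfl⟩)
      · exact hl _ _ h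
      · have := hl' v'
        have := hl' w'
        omega
    · rw [hmu]
      exact hb₁
    · rw [hmr y huy.ne' hxy.symm]
      simp [l']

/-- A sender with a level function separating its two edges. -/
structure FarSender (q : ℕ) {VH V : Type*} (H : SimpleGraph VH) (L : ℕ) (G : SimpleGraph V)
    (a₀ a₁ b₀ b₁ : V) (h : V → ℕ) : Prop extends Sender q H G a₀ a₁ b₀ b₁ where
  lip : ∀ x y, G.Adj x y → h x ≤ h y + 1
  level_a₀ : h a₀ = 0
  level_a₁ : h a₁ = 0
  level_b₀ : h b₀ = L
  level_b₁ : h b₁ = L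

theorem exists_farSender {VH : Type} [Fintype VH] {H : SimpleGraph VH} (hH : Robust H)
    {q : ℕ} (hq : 2 ≤ q) {L : ℕ} (hL : 0 < L) : ∃ (V : Type) (_ : Fintype V)
      (G : SimpleGraph V) (a₀ a₁ b₀ b₁ : V) (h : V → ℕ), FarSender q H L G a₀ a₁ b₀ b₁ h := by
  obtain ⟨V, _, G, a₀, a₁, b₀, b₁, l, hG, hl, ha₀, ha₁, hb₀, hb₁⟩ :=
    exists_chain_sender hH hq (2 * L - 1)
  refine ⟨V, inferInstance, G, a₀, a₁, b₀, b₁, fun v => min L (l v / 2), hG, fun x y hxy => ?_,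
    ?_, ?_, ?_, ?_⟩
  · have := hl x y hxy
    omega
  all_goals omega

/-! ### Attaching far senders to a graph -/

/-- The graph `B'` contains `B` (via `ι`); its `H`-free colourings restrict to exactly those
`H`-free colourings of `B` in which the two edges of each pair in `P` have the same colour, and
integer potentials on `B` that are constant on the edges in `P` and vary by at most `L` between
the edges of a pair extend to `B'`. -/
structure IsExtension (q : ℕ) {VH V V' : Type*} (H : SimpleGraph VH) (L : ℕ) (B : SimpleGraph V)
    (P : List ((V × V) × V × V)) (B' : SimpleGraph V') (ι : V ↪ V') : Prop where
  adj : ∀ x y, B.Adj x y → B'.Adj (ι x) (ι y)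
  forced : ∀ c : Sym2 V' → Fin q, ¬ HasMonoCopy B' H c →
    ∀ p ∈ P, c s(ι p.1.1, ι p.1.2) = c s(ι p.2.1, ι p.2.2)
  extend : ∀ c : Sym2 V → Fin q, ¬ HasMonoCopy B H c →
    (∀ p ∈ P, c s(p.1.1, p.1.2) = c s(p.2.1, p.2.2)) →
    ∃ c' : Sym2 V' → Fin q, ¬ HasMonoCopy B' H c' ∧
      ∀ x y, B.Adj x y → c' s(ι x, ι y) = c s(x, y)
  lipschitz : ∀ g : V → ℤ, (∀ x y, B.Adj x y → g x ≤ g y + 1) →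
    (∀ p ∈ P, g p.1.1 = g p.1.2 ∧ g p.2.1 = g p.2.2 ∧ |g p.1.1 - g p.2.1| ≤ L) →
    ∃ g' : V' → ℤ, (∀ x y, B'.Adj x y → g' x ≤ g' y + 1) ∧ ∀ x, g' (ι x) = g x

/-- A long sender glued at two disjoint edges does not create new copies of `H`. -/
theorem FarSender.copy_confined {VH V W : Type*} [Fintype VH] {H : SimpleGraph VH}
    (hH : Robust H) {q L : ℕ} (hL : Fintype.card VH + 2 ≤ L) {S : SimpleGraph W}
    {a₀ a₁ b₀ b₁ : W} {h : W → ℕ} (hS : FarSender q H L S a₀ a₁ b₀ b₁ h)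
    {B : SimpleGraph V} {x₀ x₁ y₀ y₁ : V} (hx : B.Adj x₀ x₁) (hy : B.Adj y₀ y₁)
    {m : W ↪ V ⊕ W} (ha₀ : m a₀ = .inl x₀) (ha₁ : m a₁ = .inl x₁) (hb₀ : m b₀ = .inl y₀)
    (hb₁ : m b₁ = .inl y₁)
    (hm : ∀ w v, m w = .inl v → (w = a₀ ∨ w = a₁) ∨ (w = b₀ ∨ w = b₁)) {f : VH ↪ V ⊕ W}
    (hf : IsCopy H (B.map Function.Embedding.inl ⊔ S.map m) f) :
    IsCopy H (B.map Function.Embedding.inl) f ∨ IsCopy H (S.map m) f := by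
  classical
  obtain ⟨l, hl, hlevel⟩ : ∃ l ∈ Finset.Icc 1 (Fintype.card VH + 1),
      ∀ a w, m w = f a → h w ≠ l := by
    let g : VH → ℕ := fun a => if hw : ∃ w, m w = f a then h hw.choose else 0
    obtain ⟨l, hl, hlg⟩ := Finset.exists_mem_notMem_of_card_lt_card
      (s := Finset.univ.image g) (t := Finset.Icc 1 (Fintype.card VH + 1))
      (Finset.card_image_le.trans_lt (by simp))
    refine ⟨l, hl, fun a w hw hwl => hlg (Finset.mem_image.2 ⟨a, Finset.mem_univ a, ?_⟩)⟩
    have hex : ∃ w, m w = f a := ⟨w, hw⟩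
    have : hex.choose = w := m.injective (hex.choose_spec.trans hw.symm)
    rw [← hwl]
    exact (dif_pos hex).trans (congrArg h this)
  rw [Finset.mem_Icc] at hl
  let S' : (ℕ → Prop) → SimpleGraph W := fun p =>
    { Adj := fun w w' => S.Adj w w' ∧ p (h w) ∧ p (h w')
      symm := ⟨fun _ _ h => ⟨h.1.symm, h.2.2, h.2.1⟩⟩
      loopless := ⟨fun _ h => h.1.ne rfl⟩ }
  have hle : ∀ p, (S' p).map m ≤ S.map m := fun p => map_monotone m fun _ _ h => h.1
  have hinl : ∀ {x y}, B.Adj x y → (B.map Function.Embedding.inl).Adj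
      (.inl x : V ⊕ W) (.inl y) := fun h => map_adj_apply (f := Function.Embedding.inl).2 h
  have hsplit : IsCopy H ((B.map Function.Embedding.inl ⊔ (S' (· < l)).map m) ⊔
      (S' (l < ·)).map m) f := by
    intro a b hab
    rcases hf a b hab with h' | h'
    · exact .inl (.inl h')
    · obtain ⟨w, w', hww, hw, hw'⟩ := (map_adj _ _ _ _).1 h'
      have h1 := hlevel a w hw
      have h2 := hlevel b w' hw'
      have h3 := hS.lip w w' hww
      have h4 := hS.lip w' w hww.symm
      rw [← hw, ← hw']
      rcases lt_or_gt_of_ne h1 with h5 | h5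
      · exact .inl (.inr (map_adj_apply.2 ⟨hww, h5, by omega⟩))
      · exact .inr (map_adj_apply.2 ⟨hww, h5, show l < h w' by omega⟩)
  have hBS : ∀ (p : ℕ → Prop) {x y}, ((S' p).map m).Adj x y → ∃ w, m w = x ∧ p (h w) := by
    rintro p x y h'
    obtain ⟨w, w', hww, hw, hw'⟩ := (map_adj _ _ _ _).1 h'
    exact ⟨w, hw, hww.2.1⟩
  have hBr : ∀ {x y}, (B.map Function.Embedding.inl).Adj (x : V ⊕ W) y → ∃ v, .inl v = x := by
    rintro x y h'
    obtain ⟨w, w', hww, hw, hw'⟩ := (map_adj _ _ _ _).1 h'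
    exact ⟨w, hw⟩
  have h0 := hS.level_a₀
  have h1 := hS.level_a₁
  have h2 := hS.level_b₀
  have h3 := hS.level_b₁
  rcases hsplit.of_sup hH (G₁ := B.map Function.Embedding.inl ⊔ (S' (· < l)).map m)
      (G₂ := (S' (l < ·)).map m) (S₁ := {z | (∃ v, .inl v = z) ∨ ∃ w, m w = z ∧ h w < l})
      (S₂ := {z | ∃ w, m w = z ∧ l < h w}) (u := .inl y₀) (v := .inl y₁)
      (fun x y h' => h'.imp hBr (hBS (· < l))) (fun x y h' => hBS (l < ·) h') (by
        rintro _ (⟨v, rfl⟩ | ⟨w, rfl, hw⟩) ⟨w', hw', hlw⟩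
        · rcases hm w' v hw' with (rfl | rfl) | (rfl | rfl)
          · omega
          · omega
          · exact .inl (hw'.symm.trans hb₀)
          · exact .inr (hw'.symm.trans hb₁)
        · rw [m.injective hw'] at hlw
          omega)
      (iff_of_true (.inl (hinl hy)) (by
        rw [← hb₀, ← hb₁]
        exact map_adj_apply.2 ⟨hS.adj_right, show l < h b₀ by omega, show l < h b₁ by omega⟩))
    with h' | h'
  · rcases h'.of_sup hH (G₁ := B.map Function.Embedding.inl) (G₂ := (S' (· < l)).map m) (S₁ := Set.range Sum.inl)
        (S₂ := {z | ∃ w, m w = z ∧ h w < l}) (u := .inl x₀) (v := .inl x₁)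
        (fun x y h' => hBr h') (fun x y h' => hBS (· < l) h') (by
          rintro _ ⟨v, rfl⟩ ⟨w', hw', hlw⟩
          rcases hm w' v hw' with (rfl | rfl) | (rfl | rfl)
          · exact .inl (hw'.symm.trans ha₀)
          · exact .inr (hw'.symm.trans ha₁)
          · omega
          · omega)
        (iff_of_true (hinl hx) (by
          rw [← ha₀, ← ha₁]
          exact map_adj_apply.2 ⟨hS.adj_left, show h a₀ < l by omega, show h a₁ < l by omega⟩))
      with h'' | h''
    · exact .inl h''
    · exact .inr (h''.mono (hle (· < l)))
  · exact .inr (h'.mono (hle (l < ·)))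

theorem exists_clamp {L : ℕ} {α β : ℤ} (h : |α - β| ≤ L) : ∃ k : ℕ → ℤ, k 0 = α ∧ k L = β ∧
    ∀ i j, i ≤ j + 1 → j ≤ i + 1 → k i ≤ k j + 1 := by
  rw [abs_le] at h
  rcases le_total α β with hab | hab
  · refine ⟨fun i => min (α + i) β, ?_, ?_, fun i j h h' => ?_⟩ <;> dsimp only <;> omega
  · refine ⟨fun i => max (α - i) β, ?_, ?_, fun i j h h' => ?_⟩ <;> dsimp only <;> omega

theorem exists_extension_one {VH V : Type} [Fintype VH] [Fintype V] {H : SimpleGraph VH}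
    (hH : Robust H) {q L : ℕ} (hq : 2 ≤ q) (hL : Fintype.card VH + 2 ≤ L)
    {B : SimpleGraph V} {x₀ x₁ y₀ y₁ : V} (hx : B.Adj x₀ x₁) (hy : B.Adj y₀ y₁)
    (hxy : x₀ ≠ y₀ ∧ x₀ ≠ y₁ ∧ x₁ ≠ y₀ ∧ x₁ ≠ y₁) :
    ∃ (V' : Type) (_ : Fintype V') (B' : SimpleGraph V') (ι : V ↪ V'),
      IsExtension q H L B [((x₀, x₁), y₀, y₁)] B' ι := by
  classical
  obtain ⟨W, _, S, a₀, a₁, b₀, b₁, h, hS⟩ := exists_farSender hH hq (L := L) (by omega)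
  have h0 := hS.level_a₀
  have h1 := hS.level_a₁
  have h2 := hS.level_b₀
  have h3 := hS.level_b₁
  have haa := hS.adj_left.ne
  have hbb := hS.adj_right.ne
  have hab : a₀ ≠ b₀ ∧ a₀ ≠ b₁ ∧ a₁ ≠ b₀ ∧ a₁ ≠ b₁ := by
    refine ⟨?_, ?_, ?_, ?_⟩ <;> rintro rfl <;> omega
  obtain ⟨hab₁, hab₂, hab₃, hab₄⟩ := hab
  obtain ⟨hxy₁, hxy₂, hxy₃, hxy₄⟩ := hxy
  have hxx := hx.ne
  have hyy := hy.ne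
  let t : W → Option V := fun w => if w = a₀ then some x₀ else if w = a₁ then some x₁ else
    if w = b₀ then some y₀ else if w = b₁ then some y₁ else none
  have ht : ∀ w w' v, t w = some v → t w' = some v → w = w' := by
    intro w w' v h h'
    simp only [t] at h h'
    split_ifs at h h' <;> simp_all
  let m := attach t ht
  have ha₀ : m a₀ = .inl x₀ := attach_some (by simp [t])
  have ha₁ : m a₁ = .inl x₁ := attach_some (by simp [t, haa.symm])
  have hb₀ : m b₀ = .inl y₀ := attach_some (by simp [t, hab₁.symm, hab₃.symm])
  have hb₁ : m b₁ = .inl y₁ := attach_some (by simp [t, hab₂.symm, hab₄.symm, hbb.symm])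
  have hm : ∀ w v, m w = .inl v → (w = a₀ ∨ w = a₁) ∨ (w = b₀ ∨ w = b₁) := by
    intro w v h
    have := attach_eq_inl h
    simp only [t] at this
    split_ifs at this <;> simp_all
  refine ⟨V ⊕ W, inferInstance, B.map Function.Embedding.inl ⊔ S.map m, Function.Embedding.inl,
    fun x y hxy => .inl (map_adj_apply (f := Function.Embedding.inl).2 hxy), ?_, ?_, ?_⟩
  · intro c hc p hp
    rw [List.mem_singleton] at hp
    subst hp
    have h₂ := hS.forced (fun s => c (s.map m)) fun h => hc (h.map.mono le_sup_right fun _ _ _ => rfl)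
    change c s(m a₀, m a₁) = c s(m b₀, m b₁) at h₂
    rwa [ha₀, ha₁, hb₀, hb₁] at h₂
  · intro c hc hp
    have hp : c s(x₀, x₁) = c s(y₀, y₁) := hp _ (List.mem_singleton_self _)
    obtain ⟨c₀, hc₀⟩ := not_forall.1 hS.not_ramsey
    let σ := Equiv.swap (c₀ s(a₀, a₁)) (c s(x₀, x₁))
    have hσ : σ (c₀ s(a₀, a₁)) = c s(x₀, x₁) := Equiv.swap_apply_left _ _
    have hσ' : σ (c₀ s(b₀, b₁)) = c s(y₀, y₁) := by rw [← hS.forced c₀ hc₀, hσ, hp]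
    have hc' : ¬ HasMonoCopy S H fun s => σ (c₀ s) := fun h => hc₀ (h.of_perm _)
    have hlip : ∀ a b, S.Adj a b → (h a = 0 → h b = L → False) := by
      intro a b hab h h'
      have := hS.lip b a hab.symm
      omega
    obtain ⟨d, hd, hd'⟩ := exists_glued_colouring (by omega) (G := B) (S := S)
      Function.Embedding.inl m c (fun s => σ (c₀ s)) (by
        have key : ∀ a' b' v w, S.Adj a' b' → m a' = .inl v → m b' = .inl w →
            s(a', b') = s(a₀, a₁) ∧ s(v, w) = s(x₀, x₁) ∨
              s(a', b') = s(b₀, b₁) ∧ s(v, w) = s(y₀, y₁) := by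
          intro a' b' v w hab hv hw
          have e1 := hlip a' b' hab
          have e2 := hlip b' a' hab.symm
          have e3 := hab.ne
          rcases hm a' v hv with (rfl | rfl) | (rfl | rfl) <;>
            rcases hm b' w hw with (rfl | rfl) | (rfl | rfl) <;> simp_all [Sym2.eq_swap]
        intro a b a' b' _ hab ha hb
        rcases key a' b' a b hab ha.symm hb.symm with ⟨h, h'⟩ | ⟨h, h'⟩
        · rw [h, h', hσ]
        · rw [h, h', hσ'])
    exact ⟨d, not_hasMonoCopy_sup_map hH (fun f hf => hS.copy_confined hH hL hx hy ha₀ ha₁ hb₀ hb₁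
      hm hf) hc hc' hd hd', hd⟩
  · intro g hg hp
    obtain ⟨e₁, e₂, e₃⟩ := hp _ (List.mem_singleton_self _)
    dsimp only at e₁ e₂ e₃
    obtain ⟨k, hk₀, hk₁, hk⟩ := exists_clamp e₃
    let g' : V ⊕ W → ℤ := Sum.elim g fun w => k (h w)
    have hg' : ∀ w, g' (m w) = k (h w) := by
      intro w
      match hw : m w with
      | .inl v =>
        change g v = _
        rcases hm w v hw with (rfl | rfl) | (rfl | rfl)
        · rw [h0, hk₀, ← Sum.inl_injective (hw.symm.trans ha₀)]
        · rw [h1, hk₀, e₁, ← Sum.inl_injective (hw.symm.trans ha₁)]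
        · rw [h2, hk₁, ← Sum.inl_injective (hw.symm.trans hb₀)]
        · rw [h3, hk₁, e₂, ← Sum.inl_injective (hw.symm.trans hb₁)]
      | .inr w' =>
        match e : t w with
        | some v =>
          rw [show m w = .inl v from attach_some e] at hw
          cases hw
        | none =>
          rw [show m w = .inr w from attach_none e] at hw
          cases hw
          rfl
    refine ⟨g', ?_, fun _ => rfl⟩
    rintro v w (⟨-, v', w', h, rfl, rfl⟩ | ⟨-, v', w', h, rfl, rfl⟩)
    · exact hg _ _ h
    · rw [hg', hg']
      exact hk _ _ (hS.lip _ _ h) (hS.lip _ _ h.symm)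

theorem exists_extension {VH V : Type} [Fintype VH] [Fintype V] {H : SimpleGraph VH}
    (hH : Robust H) {q L : ℕ} (hq : 2 ≤ q) (hL : Fintype.card VH + 2 ≤ L)
    {B : SimpleGraph V} (P : List ((V × V) × V × V))
    (hP : ∀ p ∈ P, B.Adj p.1.1 p.1.2 ∧ B.Adj p.2.1 p.2.2 ∧
      p.1.1 ≠ p.2.1 ∧ p.1.1 ≠ p.2.2 ∧ p.1.2 ≠ p.2.1 ∧ p.1.2 ≠ p.2.2) :
    ∃ (V' : Type) (_ : Fintype V') (B' : SimpleGraph V') (ι : V ↪ V'),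
      IsExtension q H L B P B' ι := by
  induction P with
  | nil =>
    exact ⟨V, inferInstance, B, .refl V, fun _ _ h => h, fun _ _ p hp => by simp at hp,
      fun c hc _ => ⟨c, hc, fun _ _ _ => rfl⟩, fun g hg _ => ⟨g, hg, fun _ => rfl⟩⟩
  | cons p P ih =>
    obtain ⟨V₁, _, B₁, ι, h₁⟩ := ih fun p' hp' => hP p' (List.mem_cons_of_mem _ hp')
    obtain ⟨hx, hy, hne⟩ := hP p List.mem_cons_self
    obtain ⟨V₂, _, B₂, ι', h₂⟩ := exists_extension_one hH hq hL (h₁.adj _ _ hx) (h₁.adj _ _ hy)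
      (by simpa only [ne_eq, ι.injective.eq_iff] using hne)
    refine ⟨V₂, inferInstance, B₂, ι.trans ι', fun x y h => h₂.adj _ _ (h₁.adj _ _ h), ?_, ?_, ?_⟩
    · intro c hc
      refine List.forall_mem_cons.2 ⟨h₂.forced c hc _ (List.mem_singleton_self _), ?_⟩
      exact h₁.forced (fun s => c (s.map ι')) fun h => hc (h.map.mono
        (by
          rintro _ _ ⟨-, x, y, h, rfl, rfl⟩
          exact h₂.adj _ _ h) fun _ _ _ => rfl)
    · intro c hc hp
      rw [List.forall_mem_cons] at hp
      obtain ⟨c₁, hc₁, hcc₁⟩ := h₁.extend c hc hp.2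
      obtain ⟨c₂, hc₂, hcc₂⟩ := h₂.extend c₁ hc₁ (by
        rintro p' hp'
        rw [List.mem_singleton] at hp'
        subst hp'
        dsimp only
        rw [hcc₁ _ _ hx, hcc₁ _ _ hy, hp.1])
      exact ⟨c₂, hc₂, fun x y h => (hcc₂ _ _ (h₁.adj _ _ h)).trans (hcc₁ _ _ h)⟩
    · intro g hg hp
      rw [List.forall_mem_cons] at hp
      obtain ⟨g₁, hg₁, hgg₁⟩ := h₁.lipschitz g hg hp.2
      obtain ⟨g₂, hg₂, hgg₂⟩ := h₂.lipschitz g₁ hg₁ (by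
        rintro p' hp'
        rw [List.mem_singleton] at hp'
        subst hp'
        simpa only [hgg₁] using hp.1)
      exact ⟨g₂, hg₂, fun x => (hgg₂ _).trans (hgg₁ x)⟩

theorem IsExtension.relabel {VH V V' U : Type*} [Fintype VH] {q L : ℕ} {H : SimpleGraph VH}
    (hH : Robust H) {B : SimpleGraph V} {P : List ((V × V) × V × V)} {B' : SimpleGraph V'}
    {ι : V ↪ V'} (h : IsExtension q H L B P B' ι) (e : V' ≃ U) :
    IsExtension q H L B P (B'.map e.toEmbedding) (ι.trans e.toEmbedding) where
  adj x y hxy := map_adj_apply.2 (h.adj x y hxy)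
  forced c hc := h.forced (fun s => c (s.map e.toEmbedding)) fun h => hc h.map
  extend c hc hp := by
    obtain ⟨c', hc', hcc⟩ := h.extend c hc hp
    refine ⟨fun s => c' (s.map e.symm), fun hm => hc' ((hm.of_map hH).mono le_rfl
      fun x y _ => ?_), fun x y hxy => ?_⟩
    · change _ = c' s(e.symm (e x), e.symm (e y))
      simp
    · change c' s(e.symm (e (ι x)), e.symm (e (ι y))) = _
      simpa using hcc x y hxy
  lipschitz g hg hp := by
    obtain ⟨g', hg', hgg⟩ := h.lipschitz g hg hp
    refine ⟨fun u => g' (e.symm u), ?_, fun x => ?_⟩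
    · rintro _ _ ⟨-, x, y, hxy, rfl, rfl⟩
      simpa using hg' x y hxy
    · simpa using hgg x

/-! ### Realising constraints on the colours of given edges -/

/-- Disjoint edges indexed by `T` together with disjoint copies of `H` indexed by `J`. -/
def constraintBase {VH : Type*} (H : SimpleGraph VH) (T J : Type*) :
    SimpleGraph (T × Bool ⊕ J × VH) where
  Adj
    | .inl x, .inl y => x.1 = y.1 ∧ x.2 ≠ y.2
    | .inr x, .inr y => x.1 = y.1 ∧ H.Adj x.2 y.2
    | _, _ => False
  symm := ⟨by
    rintro (x | x) (y | y) h
    exacts [⟨h.1.symm, h.2.symm⟩, h, h, ⟨h.1.symm, h.2.symm⟩]⟩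
  loopless := ⟨by
    rintro (x | x) h
    exacts [h.2 rfl, h.2.ne rfl]⟩

theorem constraintBase_copy {VH T J : Type*} [Fintype VH] {H : SimpleGraph VH} (hH : Robust H)
    {f : VH ↪ T × Bool ⊕ J × VH} (hf : IsCopy H (constraintBase H T J) f) :
    ∃ j, ∀ v w, H.Adj v w → ∃ a b, H.Adj a b ∧
      s(f a, f b) = s(.inr (j, v), .inr (j, w)) := by
  have hinr : ∀ a, ∃ x, f a = .inr x := by
    intro a
    match ha : f a with
    | .inr x => exact ⟨x, rfl⟩
    | .inl x =>
      obtain ⟨b, hb⟩ := hH.exists_adj a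
      obtain ⟨b', hb', hne⟩ := hH.exists_adj_ne a b
      have hkey : ∀ b, H.Adj a b → f b = .inl (x.1, !x.2) := by
        intro b hb
        have := hf a b hb
        rw [ha] at this
        match hb : f b with
        | .inl y =>
          rw [hb] at this
          exact congrArg Sum.inl (Prod.ext this.1.symm (Bool.eq_not.2 this.2.symm))
        | .inr y =>
          rw [hb] at this
          exact this.elim
      exact absurd (f.injective ((hkey b' hb').trans (hkey b hb).symm)) hne
  choose g hg using hinr
  have hadj : ∀ a b, H.Adj a b → (g a).1 = (g b).1 ∧ H.Adj (g a).2 (g b).2 := by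
    intro a b hab
    have := hf a b hab
    rwa [hg, hg] at this
  obtain ⟨a₀⟩ := hH.nonempty
  have hconst : ∀ a, (g a).1 = (g a₀).1 := by
    have hpre := (hH.conn ∅ (by simp)).preconnected
    have hwalk : ∀ a b : ↥((↑(∅ : Finset VH) : Set VH)ᶜ), (g a).1 = (g b).1 := by
      intro a b
      obtain ⟨p⟩ := hpre a b
      induction p with
      | nil => rfl
      | cons h _ ih => exact (hadj _ _ h).1.trans ih
    exact fun a => hwalk ⟨a, by simp⟩ ⟨a₀, by simp⟩
  let σ : H →g H := ⟨fun a => (g a).2, fun {a b} h => (hadj a b h).2⟩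
  have hσ : Function.Injective σ := by
    intro a b h
    refine f.injective ?_
    rw [hg, hg]
    exact congrArg Sum.inr (Prod.ext ((hconst a).trans (hconst b).symm) h)
  have hsurj : Function.Surjective σ.mapEdgeSet :=
    Finite.injective_iff_surjective.1 (Hom.mapEdgeSet.injective σ hσ)
  refine ⟨(g a₀).1, fun v w hvw => ?_⟩
  obtain ⟨⟨s, hs⟩, hs'⟩ := hsurj ⟨s(v, w), hvw⟩
  induction s with | _ a b
  refine ⟨a, b, hs, ?_⟩
  have hs'' : s((g a).2, (g b).2) = s(v, w) := congrArg Subtype.val hs'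
  have : ∀ a, f a = .inr ((g a₀).1, (g a).2) := fun a => by
    rw [hg, ← hconst a]
  rw [this a, this b]
  exact congrArg (Sym2.map fun v => (Sum.inr ((g a₀).1, v) : T × Bool ⊕ J × VH)) hs''

theorem Robust.exists_three_edges {VH : Type*} [Fintype VH] {H : SimpleGraph VH}
    (hH : Robust H) : ∃ a₀ b₀ a₁ b₁ a₂ b₂, H.Adj a₀ b₀ ∧ H.Adj a₁ b₁ ∧ H.Adj a₂ b₂ ∧
      s(a₁, b₁) ≠ s(a₀, b₀) ∧ s(a₂, b₂) ≠ s(a₀, b₀) ∧ s(a₂, b₂) ≠ s(a₁, b₁) := by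
  obtain ⟨a⟩ := hH.nonempty
  obtain ⟨b, hb⟩ := hH.exists_adj a
  obtain ⟨c, hc, hcb⟩ := hH.exists_adj_ne a b
  obtain ⟨d, hd, hda⟩ := hH.exists_adj_ne b a
  refine ⟨a, b, a, c, b, d, hb, hc, hd, ?_, ?_, ?_⟩ <;>
    simp only [ne_eq, Sym2.eq_iff] <;> have := hb.ne <;> grind

/-- Given a set `𝒜` of assignments of colours to the elements of `T`, there is a graph with
far apart edges indexed by `T` such that each assignment in `𝒜` is realised by an `H`-free
colouring and every `H`-free colouring satisfies all not-all-equal constraints on at most three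
edges that hold in `𝒜`. -/
theorem exists_constraint_graph {VH T : Type} [Fintype VH] [Fintype T] {H : SimpleGraph VH}
    (hH : Robust H) {q : ℕ} (hq : 2 ≤ q) (𝒜 : Set (T → Fin q)) (D : ℕ) :
    ∃ (n : ℕ) (G : SimpleGraph (Fin n)) (τ : T → Bool → Fin n),
      (∀ t, G.Adj (τ t false) (τ t true)) ∧
      (∀ t, ∃ g : Fin n → ℤ, (∀ x y, G.Adj x y → g x ≤ g y + 1) ∧ (∀ b, g (τ t b) = 0) ∧
        ∀ t', t' ≠ t → ∀ b, g (τ t' b) = D) ∧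
      (∀ c : Sym2 (Fin n) → Fin q, ¬ HasMonoCopy G H c → ∀ t₀ t₁ t₂ : T,
        (∀ a ∈ 𝒜, a t₀ = a t₁ → a t₁ ≠ a t₂) →
        c s(τ t₀ false, τ t₀ true) = c s(τ t₁ false, τ t₁ true) →
        c s(τ t₁ false, τ t₁ true) ≠ c s(τ t₂ false, τ t₂ true)) ∧
      (∀ a ∈ 𝒜, ∃ c : Sym2 (Fin n) → Fin q, ¬ HasMonoCopy G H c ∧
        ∀ t, c s(τ t false, τ t true) = a t) := by
  classical
  obtain ⟨a₀, b₀, a₁, b₁, a₂, b₂, h₀, h₁, h₂, hne₁, hne₂, hne₃⟩ := hH.exists_three_edges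
  let J := {p : T × T × T // ∀ a ∈ 𝒜, a p.1 = a p.2.1 → a p.2.1 ≠ a p.2.2}
  let lab : J → Sym2 VH → T := fun j s =>
    if s = s(a₀, b₀) then j.1.1 else if s = s(a₁, b₁) then j.1.2.1 else j.1.2.2
  have hlab₀ : ∀ j, lab j s(a₀, b₀) = j.1.1 := fun j => if_pos rfl
  have hlab₁ : ∀ j, lab j s(a₁, b₁) = j.1.2.1 := fun j => by simp [lab, hne₁]
  have hlab₂ : ∀ j, lab j s(a₂, b₂) = j.1.2.2 := fun j => by simp [lab, hne₂, hne₃]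
  let V := T × Bool ⊕ J × VH
  let B := constraintBase H T J
  let pr : J × VH × VH → (V × V) × V × V := fun x =>
    ((.inr (x.1, x.2.1), .inr (x.1, x.2.2)),
      .inl (lab x.1 s(x.2.1, x.2.2), false), .inl (lab x.1 s(x.2.1, x.2.2), true))
  let P : List ((V × V) × V × V) :=
    (Finset.univ.filter fun x : J × VH × VH => H.Adj x.2.1 x.2.2).toList.map pr
  have hmem : ∀ Q : (V × V) × V × V → Prop, (∀ p ∈ P, Q p) ↔
      ∀ j v w, H.Adj v w → Q (pr (j, v, w)) := by
    intro Q
    simp only [P, List.forall_mem_map, Finset.mem_toList, Finset.mem_filter, Finset.mem_univ,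
      true_and]
    exact ⟨fun h j v w => h (j, v, w), fun h x => h x.1 x.2.1 x.2.2⟩
  obtain ⟨V', _, B', ι, hB⟩ := exists_extension hH hq (L := max D (Fintype.card VH + 2))
    (le_max_right _ _) (B := B) P ((hmem _).2 fun j v w hvw =>
      ⟨⟨rfl, hvw⟩, ⟨rfl, Bool.false_ne_true⟩, Sum.inr_ne_inl, Sum.inr_ne_inl, Sum.inr_ne_inl,
        Sum.inr_ne_inl⟩)
  obtain ⟨n, ⟨e⟩⟩ := Finite.exists_equiv_fin V'
  replace hB := hB.relabel hH e
  generalize B'.map e.toEmbedding = G at hB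
  generalize ι.trans e.toEmbedding = κ at hB
  refine ⟨n, G, fun t b => κ (.inl (t, b)), fun t => hB.adj _ _ ⟨rfl, Bool.false_ne_true⟩,
    fun t => ?_, fun c hc t₀ t₁ t₂ ht e₁ e₂ => ?_, fun a ha => ?_⟩
  · obtain ⟨g, hg, hgg⟩ := hB.lipschitz
      (Sum.elim (fun x => if x.1 = t then 0 else (D : ℤ)) fun _ => (D : ℤ)) (by
        rintro (x | x) (y | y) hxy
        · have : x.1 = y.1 := hxy.1
          simp only [Sum.elim_inl, this]
          omega
        · exact hxy.elim
        · exact hxy.elim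
        · simp) ((hmem _).2 fun j v w _ => by
          refine ⟨rfl, rfl, ?_⟩
          simp only [pr, Sum.elim_inl, Sum.elim_inr, abs_le]
          split_ifs <;> omega)
    refine ⟨g, hg, fun b => ?_, fun t' ht' b => ?_⟩
    · rw [hgg]
      simp
    · rw [hgg]
      simp [ht']
  · let j : J := ⟨(t₀, t₁, t₂), ht⟩
    refine hc ⟨c s(κ (.inl (t₀, false)), κ (.inl (t₀, true))),
      ⟨fun v => κ (.inr (j, v)), fun v w h => ?_⟩, fun v w hvw => ⟨hB.adj _ _ ⟨rfl, hvw⟩, ?_⟩⟩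
    · simpa using h
    · refine ((hmem _).1 (hB.forced c hc) j v w hvw).trans ?_
      simp only [pr, lab, j]
      split_ifs
      exacts [rfl, e₁.symm, (e₁.trans e₂).symm]
  · obtain ⟨c, hcol⟩ := exists_colouring (V := V) (q := q) (by omega)
      (fun x y i => (∃ t b b', b ≠ b' ∧ x = .inl (t, b) ∧ y = .inl (t, b') ∧ i = a t) ∨
        ∃ j v w, H.Adj v w ∧ x = .inr (j, v) ∧ y = .inr (j, w) ∧ i = a (lab j s(v, w)))
      (by
        rintro x y i (⟨t, b, b', h, rfl, rfl, rfl⟩ | ⟨j, v, w, h, rfl, rfl, rfl⟩)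
        · exact .inl ⟨t, b', b, h.symm, rfl, rfl, rfl⟩
        · exact .inr ⟨j, w, v, h.symm, rfl, rfl, by rw [Sym2.eq_swap]⟩)
      (by
        rintro x y i i' (⟨t, b, b', h, rfl, rfl, rfl⟩ | ⟨j, v, w, h, rfl, rfl, rfl⟩)
          (⟨t', b₁, b₁', h', e₁, e₂, rfl⟩ | ⟨j', v', w', h', e₁, e₂, rfl⟩)
        · rw [(Prod.mk.inj (Sum.inl.inj e₁)).1]
        · cases e₁
        · cases e₁
        · obtain ⟨rfl, rfl⟩ := Prod.mk.inj (Sum.inr.inj e₁)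
          rw [(Prod.mk.inj (Sum.inr.inj e₂)).2])
    have hcT : ∀ t, c s(.inl (t, false), .inl (t, true)) = a t := fun t =>
      hcol _ _ _ (.inl ⟨t, _, _, Bool.false_ne_true, rfl, rfl, rfl⟩)
    have hcJ : ∀ j v w, H.Adj v w → c s(.inr (j, v), .inr (j, w)) = a (lab j s(v, w)) :=
      fun j v w h => hcol _ _ _ (.inr ⟨j, v, w, h, rfl, rfl, rfl⟩)
    have hfree : ¬ HasMonoCopy B H c := by
      rintro ⟨i, f, hf⟩
      obtain ⟨j, hj⟩ := constraintBase_copy hH fun a b hab => (hf a b hab).1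
      have hi : ∀ v w, H.Adj v w → a (lab j s(v, w)) = i := by
        intro v w hvw
        obtain ⟨x, y, hxy, hs⟩ := hj v w hvw
        rw [← hcJ j v w hvw, ← hs, (hf x y hxy).2]
      have e₀ := hi _ _ h₀
      have e₁ := hi _ _ h₁
      have e₂ := hi _ _ h₂
      rw [hlab₀] at e₀
      rw [hlab₁] at e₁
      rw [hlab₂] at e₂
      exact j.2 a ha (e₀.trans e₁.symm) (e₁.trans e₂.symm)
    obtain ⟨c', hc', hcc⟩ := hB.extend c hfree ((hmem _).2 fun j v w hvw =>
      (hcJ j v w hvw).trans (hcT _).symm)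
    exact ⟨c', hc', fun t => (hcc (.inl (t, false)) (.inl (t, true)) ⟨rfl, Bool.false_ne_true⟩).trans (hcT t)⟩

/-! ### The two-edge indicator -/

theorem Walk.le_add_length_of_lipschitz {V : Type*} {G : SimpleGraph V} {g : V → ℤ}
    (hg : ∀ x y, G.Adj x y → g x ≤ g y + 1) {x y : V} (p : G.Walk x y) :
    g x ≤ g y + p.length := by
  induction p with
  | nil => simp
  | cons h p ih =>
    have := hg _ _ h
    rw [Walk.length_cons]
    push_cast
    omega

theorem twoMatching_adj {a b : Fin 4} : twoMatching.Adj a b ↔ b = ![1, 0, 3, 2] a := by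
  rw [twoMatching, fromRel_adj]
  revert a b
  decide

theorem eq_of_mem_of_twoMatching_adj {a b w : Fin 4} (h : twoMatching.Adj a b)
    (hw : w ∈ s(a, b)) : s(a, b) = s(w, ![1, 0, 3, 2] w) := by
  rw [twoMatching_adj] at h
  revert a b w
  decide

/-- A graph in which the vertices of the two edges of the matching are far apart has
Property T. -/
theorem hasPropertyT_of_lipschitz {V : Type*} {d : ℕ} (hd : 0 < d) {G : SimpleGraph V}
    {φ : twoMatching ↪g G} {g : V → ℤ} (hg : ∀ x y, G.Adj x y → g x ≤ g y + 1)
    (h₀ : g (φ 0) = 0) (h₁ : g (φ 1) = 0) (h₂ : g (φ 2) = 2 * d) (h₃ : g (φ 3) = 2 * d) :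
    HasPropertyT d twoMatching G φ := by
  let S : Sym2 (Fin 4) → Set V := fun s => {v | ∀ w, w ∉ s → ∀ p : G.Walk v (φ w), d ≤ p.length}
  have hlow : ∀ v, g v ≤ d → v ∈ S s(0, 1) := by
    intro v hv w hw p
    have hp := Walk.le_add_length_of_lipschitz hg p.reverse
    rw [Walk.length_reverse] at hp
    have hφ : g (φ w) = 2 * d := by
      fin_cases w
      · simp at hw
      · simp at hw
      · exact h₂
      · exact h₃
    omega
  have hhigh : ∀ v, d ≤ g v → v ∈ S s(2, 3) := by
    intro v hv w hw p
    have hp := Walk.le_add_length_of_lipschitz hg p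
    have hφ : g (φ w) = 0 := by
      fin_cases w
      · exact h₀
      · exact h₁
      · simp at hw
      · simp at hw
    omega
  have hS : ∀ a b, twoMatching.Adj a b → φ a ∈ S s(a, b) := by
    intro a b hab
    rw [twoMatching_adj] at hab
    subst hab
    fin_cases a
    · exact hlow _ (show g (φ 0) ≤ d by omega)
    · rw [Sym2.eq_swap]
      exact hlow _ (show g (φ 1) ≤ d by omega)
    · exact hhigh _ (show d ≤ g (φ 2) by omega)
    · rw [Sym2.eq_swap]
      exact hhigh _ (show d ≤ g (φ 3) by omega)
  have h01 : twoMatching.Adj 0 1 := twoMatching_adj.2 rfl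
  have h23 : twoMatching.Adj 2 3 := twoMatching_adj.2 rfl
  refine ⟨fun s => (⊤ : G.Subgraph).induce (S s), fun a b hab => ⟨?_, ?_⟩, fun v => ?_,
    fun x y hxy => ?_, ?_⟩
  · ext v
    constructor
    · rintro ⟨hv, w, rfl⟩
      by_cases hw : w ∈ s(a, b)
      · rw [Sym2.mem_iff] at hw
        exact hw.imp (congrArg φ) (congrArg φ)
      · have : d ≤ 0 := hv w hw .nil
        omega
    · rintro (rfl | rfl)
      · exact ⟨hS a b hab, a, rfl⟩
      · exact ⟨Sym2.eq_swap ▸ hS b a hab.symm, b, rfl⟩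
  · exact ⟨hS a b hab, Sym2.eq_swap ▸ hS b a hab.symm, φ.map_adj_iff.2 hab⟩
  · rcases le_total (g v) d with hv | hv
    · exact ⟨0, 1, h01, hlow v hv⟩
    · exact ⟨2, 3, h23, hhigh v hv⟩
  · have h1 := hg x y hxy
    have h2 := hg y x hxy.symm
    by_cases hx : g x ≤ d ∧ g y ≤ d
    · exact ⟨0, 1, h01, hlow x hx.1, hlow y hx.2, hxy⟩
    · exact ⟨2, 3, h23, hhigh x (by omega), hhigh y (by omega), hxy⟩
  · rintro a b a' b' hab hab' hne v ⟨hv, hv'⟩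
    refine .inr fun w => ?_
    by_cases hw : w ∈ s(a, b)
    · exact hv' w fun hw' => hne ((eq_of_mem_of_twoMatching_adj hab hw).trans
        (eq_of_mem_of_twoMatching_adj hab' hw').symm)
    · exact hv w hw

/-- Two edges, indexed by `Fin 2`, together with `q` edges whose colours will be forced to be
pairwise distinct: there is a graph with far apart such edges in which the first of the `q` edges
copies the colour of the two edges whenever these agree, and is unconstrained otherwise. -/
theorem exists_copying_graph {VH : Type} [Fintype VH] {H : SimpleGraph VH} (hH : Robust H)
    {q : ℕ} (hq : 2 ≤ q) (D : ℕ) :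
    ∃ (n : ℕ) (G : SimpleGraph (Fin n)) (τ : Fin 3 → Bool → Fin n),
      (∀ t, G.Adj (τ t false) (τ t true)) ∧
      (∀ t, ∃ g : Fin n → ℤ, (∀ x y, G.Adj x y → g x ≤ g y + 1) ∧ (∀ b, g (τ t b) = 0) ∧
        ∀ t', t' ≠ t → ∀ b, g (τ t' b) = D) ∧
      (∀ c : Sym2 (Fin n) → Fin q, ¬ HasMonoCopy G H c →
        c s(τ 0 false, τ 0 true) = c s(τ 1 false, τ 1 true) →
        c s(τ 2 false, τ 2 true) = c s(τ 1 false, τ 1 true)) ∧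
      (∀ i j k : Fin q, (i = j → k = j) → ∃ c : Sym2 (Fin n) → Fin q, ¬ HasMonoCopy G H c ∧
        c s(τ 0 false, τ 0 true) = i ∧ c s(τ 1 false, τ 1 true) = j ∧
        c s(τ 2 false, τ 2 true) = k) := by
  let z : Fin q := ⟨0, by omega⟩
  obtain ⟨n, G, τ, hadj, hpot, hsound, hreal⟩ := exists_constraint_graph (T := Fin 2 ⊕ Fin q) hH hq
    {a | Function.Injective (fun k => a (.inr k)) ∧
      ∀ k, k ≠ z → a (.inl 0) = a (.inl 1) → a (.inl 1) ≠ a (.inr k)} D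
  let m : Fin 3 → Fin 2 ⊕ Fin q := ![.inl 0, .inl 1, .inr z]
  have hm : Function.Injective m := by
    intro a b
    fin_cases a <;> fin_cases b <;> simp [m]
  refine ⟨n, G, fun t => τ (m t), fun t => hadj _, fun t => ?_, fun c hc h => ?_,
    fun i j k hijk => ?_⟩
  · obtain ⟨g, hg, hg₀, hgD⟩ := hpot (m t)
    exact ⟨g, hg, hg₀, fun t' ht' => hgD _ (hm.ne ht')⟩
  · have hinj : Function.Injective fun k => c s(τ (.inr k) false, τ (.inr k) true) := by
      intro k l hkl
      by_contra hne
      exact hsound c hc (.inr k) (.inr l) (.inr l) (fun a ha h => (hne (ha.1 h)).elim) hkl rfl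
    obtain ⟨k, hk⟩ := Finite.injective_iff_surjective.1 hinj (c s(τ (m 1) false, τ (m 1) true))
    by_cases hkz : k = z
    · subst hkz
      exact hk
    · exact (hsound c hc (.inl 0) (.inl 1) (.inr k) (fun a ha h => ha.2 k hkz h) h hk.symm).elim
  · obtain ⟨c, hc, hcol⟩ := hreal (Sum.elim ![i, j] (Equiv.swap z k)) ⟨(Equiv.swap z k).injective, by
      intro l hl hij hjl
      have hij : i = j := hij
      have hjl : j = Equiv.swap z k l := hjl
      rw [← hijk hij, ← Equiv.swap_apply_left z k] at hjl
      exact hl ((Equiv.swap z _).injective (by simpa using hjl.symm))⟩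
    exact ⟨c, hc, hcol (.inl 0), hcol (.inl 1),
      (hcol (.inr z)).trans (Equiv.swap_apply_left z k)⟩

/-- If `H` is 3-connected or a triangle, `q, d ≥ 2`, and `F = {f₁, f₂}`
is a matching of two edges, then there is a graph `G₂` with an induced copy of `F`
(via `φ`, with `f₁ = φ(0)φ(1)` and `f₂ = φ(2)φ(3)`) and an edge `e = e₁e₂` vertex-disjoint
from it such that: every path from the copy of `F` to an endpoint of `e` has length at
least `d`; every path from an endpoint of `f₁` to an endpoint of `f₂` has length at least
`d`; (I1), (I2) and Property T hold; and (I3') holds: for every `ℓ ∈ {1,2}` and all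
colours `i ≠ j` there is an `H`-free `q`-colouring of `G₂` in which `f_ℓ` has colour `i`
and both `e` and `f_{3−ℓ}` have colour `j`. -/
theorem stmt12 {VH : Type} [Fintype VH]
    (H : SimpleGraph VH) (hH : ThreeConnOrK3 H)
    (q d : ℕ) (hq : 2 ≤ q) (hd : 2 ≤ d) :
    ∃ (n : ℕ) (G₂ : SimpleGraph (Fin n)) (φ : twoMatching ↪g G₂) (e₁ e₂ : Fin n),
      IndicatorBase q d H twoMatching G₂ φ e₁ e₂ ∧
      (∀ u v : Fin n, (u = φ 0 ∨ u = φ 1) → (v = φ 2 ∨ v = φ 3) →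
        ∀ p : G₂.Walk u v, d ≤ p.length) ∧
      -- (I3')
      (∀ i j : Fin q, i ≠ j →
        (∃ c : Sym2 (Fin n) → Fin q, ¬ HasMonoCopy G₂ H c ∧
          c s(φ 0, φ 1) = i ∧ c s(φ 2, φ 3) = j ∧ c s(e₁, e₂) = j) ∧
        (∃ c : Sym2 (Fin n) → Fin q, ¬ HasMonoCopy G₂ H c ∧
          c s(φ 2, φ 3) = i ∧ c s(φ 0, φ 1) = j ∧ c s(e₁, e₂) = j)) ∧
      HasPropertyT d twoMatching G₂ φ := by
  have hH' := hH.robust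
  obtain ⟨n, G, τ, hadj, hpot, hsound, hreal⟩ := exists_copying_graph hH' hq (2 * d)
  have hdist : ∀ t t', t ≠ t' → ∀ b b', ∀ p : G.Walk (τ t b) (τ t' b'), 2 * d ≤ p.length := by
    intro t t' htt b b' p
    obtain ⟨g, hg, hg₀, hgD⟩ := hpot t
    have hp := Walk.le_add_length_of_lipschitz hg p.reverse
    rw [Walk.length_reverse, hg₀, hgD t' htt.symm] at hp
    push_cast at hp
    omega
  have hne : ∀ t t' b b', τ t b = τ t' b' → t = t' ∧ b = b' := by
    intro t t' b b' h
    have htt : t = t' := by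
      by_contra htt
      have := hdist t t' htt b b' (Walk.nil.copy rfl h)
      rw [Walk.length_copy, Walk.length_nil] at this
      omega
    subst htt
    refine ⟨rfl, ?_⟩
    cases b <;> cases b'
    exacts [rfl, ((hadj t).ne h).elim, ((hadj t).ne h.symm).elim, rfl]
  have hiff : ∀ t t' b b', G.Adj (τ t b) (τ t' b') ↔ t = t' ∧ b ≠ b' := by
    intro t t' b b'
    constructor
    · intro h
      have htt : t = t' := by
        by_contra htt
        have := hdist t t' htt b b' (.cons h .nil)
        rw [Walk.length_cons, Walk.length_nil] at this
        omega
      subst htt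
      exact ⟨rfl, fun hb => h.ne (hb ▸ rfl)⟩
    · rintro ⟨rfl, hb⟩
      cases b <;> cases b'
      exacts [(hb rfl).elim, hadj t, (hadj t).symm, (hb rfl).elim]
  let tm : Fin 4 → Fin 3 := ![0, 0, 1, 1]
  let bm : Fin 4 → Bool := ![false, true, false, true]
  have htb : ∀ a b, tm a = tm b ∧ bm a = bm b → a = b := by decide
  have htm : ∀ a b, tm a = tm b ∧ bm a ≠ bm b ↔ b = ![1, 0, 3, 2] a := by decide
  have htm2 : ∀ a, tm a ≠ 2 := by decide
  let φ : twoMatching ↪g G :=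
    { toFun := fun a => τ (tm a) (bm a)
      inj' := fun a b h => htb a b (hne _ _ _ _ h)
      map_rel_iff' := fun {a b} => (hiff _ _ _ _).trans ((htm a b).trans twoMatching_adj.symm) }
  refine ⟨n, G, φ, τ 2 false, τ 2 true, ⟨hadj 2, ?_, ?_, ?_, ?_⟩, ?_, ?_, ?_⟩
  · exact fun a => ⟨fun h => htm2 a (hne _ _ _ _ h).1, fun h => htm2 a (hne _ _ _ _ h).1⟩
  · rintro a v (rfl | rfl) p
    · have := hdist _ _ (htm2 a) _ _ p
      omega
    · have := hdist _ _ (htm2 a) _ _ p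
      omega
  · intro i
    obtain ⟨c, hc, h0, h1, -⟩ := hreal i i i fun _ => rfl
    refine ⟨c, hc, fun a b hab => ?_⟩
    rw [twoMatching_adj] at hab
    subst hab
    fin_cases a
    · exact h0
    · rw [Sym2.eq_swap]
      exact h0
    · exact h1
    · rw [Sym2.eq_swap]
      exact h1
  · intro i c hc hF
    have h0 : c s(τ 0 false, τ 0 true) = i := hF 0 1 (twoMatching_adj.2 rfl)
    have h1 : c s(τ 1 false, τ 1 true) = i := hF 2 3 (twoMatching_adj.2 rfl)
    exact (hsound c hc (h0.trans h1.symm)).trans h1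
  · rintro u v hu hv p
    have : 2 * d ≤ p.length := by
      rcases hu with rfl | rfl <;> rcases hv with rfl | rfl <;>
        exact hdist 0 1 (by decide) _ _ p
    omega
  · intro i j hij
    obtain ⟨c, hc, h⟩ := hreal i j j fun _ => rfl
    obtain ⟨c', hc', h0', h1', h2'⟩ := hreal j i j fun h => (hij h.symm).elim
    exact ⟨⟨c, hc, h⟩, c', hc', h1', h0', h2'⟩
  · obtain ⟨g, hg, hg₀, hgD⟩ := hpot 0
    exact hasPropertyT_of_lipschitz (by omega) hg (hg₀ _) (hg₀ _)
      ((hgD 1 (by decide) _).trans (by push_cast; rfl))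
      ((hgD 1 (by decide) _).trans (by push_cast; rfl))
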